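/- The Lie algebra sl(3,ℝ) admits no hypercomplex structure, i.e., there is no pair of linear endomorphisms J₁, J₂ of sl(3,ℝ) with J₁² = J₂² = -Id, J₁J₂ = -J₂J₁, and vanishing Nijenhuis tensors N_{J₁} = N_{J₂} = N_{J₁J₂} = 0. -/

import Mathlib

/-- The Nijenhuis tensor of an endomorphism `J` of a Lie algebra:
`N_J(x,y) = [x,y] + J[Jx,y] + J[x,Jy] - [Jx,Jy]`. -/
def nijenhuis {R L : Type*} [CommRing R] [LieRing L] [Module R L]
    (J : L →ₗ[R] L) (x y : L) : L :=
  ⁅x, y⁆ + J ⁅J x, y⁆ + J ⁅x, J y⁆ - ⁅J x, J y⁆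

open Matrix

/-- Conjugation of `3 × 3` matrices attached to an involution `σ` of the index set. -/
def sconj (σ : Fin 3 → Fin 3) (M : Matrix (Fin 3) (Fin 3) ℂ) : Matrix (Fin 3) (Fin 3) ℂ :=
  (M.map (starRingEnd ℂ)).submatrix σ σ

/-- The `(1,0)`-part `V` of a hypercomplex structure on a real form of `sl(3,ℂ)` (the one fixed by
`sconj σ`), together with the quaternionic structure `ψ` which the second complex structure
induces on `V`. -/
structure IsHypercomplexPart (σ : Fin 3 → Fin 3) (V : Submodule ℂ (Matrix (Fin 3) (Fin 3) ℂ))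
    (ψ : Matrix (Fin 3) (Fin 3) ℂ → Matrix (Fin 3) (Fin 3) ℂ) : Prop where
  trace_eq_zero : ∀ v ∈ V, v.trace = 0
  lie_mem : ∀ v ∈ V, ∀ w ∈ V, v * w - w * v ∈ V
  finrank_eq : Module.finrank ℂ V = 4
  eq_zero_of_sconj_mem : ∀ v ∈ V, sconj σ v ∈ V → v = 0
  exists_add : ∀ M : Matrix (Fin 3) (Fin 3) ℂ, M.trace = 0 → ∃ v ∈ V, ∃ w ∈ V, M = v + sconj σ w
  map_mem : ∀ v ∈ V, ψ v ∈ V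
  map_smul : ∀ (a : ℂ), ∀ v ∈ V, ψ (a • v) = starRingEnd ℂ a • ψ v
  map_map : ∀ v ∈ V, ψ (ψ v) = -v
  cocycle : ∀ v ∈ V, ∀ w ∈ V,
    sconj σ (ψ (v * w - w * v)) - (sconj σ (ψ v) * w - w * sconj σ (ψ v))
      - (v * sconj σ (ψ w) - sconj σ (ψ w) * v) ∈ V

theorem exists_eq_sum_smul_of_linearIndependent {W : Type*} [AddCommGroup W] [Module ℂ W]
    [FiniteDimensional ℂ W] {V : Submodule ℂ W} (hV : Module.finrank ℂ V = 4) {b : Fin 4 → W}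
    (hb : ∀ i, b i ∈ V) (hli : LinearIndependent ℂ b) {v : W} (hv : v ∈ V) :
    ∃ c : Fin 4 → ℂ, v = ∑ i, c i • b i := by
  have h1 : Submodule.span ℂ (Set.range b) = V := by
    apply Submodule.eq_of_le_of_finrank_le
    · rw [Submodule.span_le]; rintro _ ⟨i, rfl⟩; exact hb i
    · rw [hV, finrank_span_eq_card hli]; simp
  rw [← h1, Submodule.mem_span_range_iff_exists_fun] at hv
  obtain ⟨c, hc⟩ := hv
  exact ⟨c, hc.symm⟩

theorem exists_smul_add_smul_mem {W : Type*} [AddCommGroup W] [Module ℂ W]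
    [FiniteDimensional ℂ W] {V B : Submodule ℂ W} (hV : Module.finrank ℂ V = 4) (hVB : V ≤ B)
    (hB : Module.finrank ℂ B ≤ 5) {a b : W} (ha : a ∈ B) (hb : b ∈ B) :
    ∃ s t : ℂ, (s ≠ 0 ∨ t ≠ 0) ∧ s • a + t • b ∈ V := by
  by_cases haV : a ∈ V
  · exact ⟨1, 0, by simp, by simpa using haV⟩
  have hlt : V < V ⊔ Submodule.span ℂ {a} := by
    refine lt_of_le_of_ne le_sup_left fun h => haV ?_
    rw [h]
    exact Submodule.mem_sup_right (Submodule.mem_span_singleton_self a)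
  have hle : V ⊔ Submodule.span ℂ {a} ≤ B :=
    sup_le hVB (by simpa [Submodule.span_le] using ha)
  have h5 := Submodule.finrank_lt_finrank_of_lt hlt
  have heq := Submodule.eq_of_le_of_finrank_le hle (by omega)
  rw [← heq, Submodule.mem_sup] at hb
  obtain ⟨y, hy, z, hz, rfl⟩ := hb
  obtain ⟨r, rfl⟩ := Submodule.mem_span_singleton.mp hz
  exact ⟨-r, 1, by simp, by simpa using hy⟩

theorem finrank_le_five_of_entries {B : Submodule ℂ (Matrix (Fin 3) (Fin 3) ℂ)}
    (hB : ∀ v ∈ B, v 1 0 = 0 ∧ v 2 0 = 0 ∧ v 1 2 = 0 ∧ v.trace = 0) :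
    Module.finrank ℂ B ≤ 5 := by
  let f : B →ₗ[ℂ] (Fin 5 → ℂ) :=
    { toFun := fun v => ![v.1 0 0, v.1 1 1, v.1 0 1, v.1 0 2, v.1 2 1]
      map_add' := by intro v w; ext i; fin_cases i <;> simp
      map_smul' := by intro r v; ext i; fin_cases i <;> simp }
  have hf : Function.Injective f := by
    rw [← LinearMap.ker_eq_bot, LinearMap.ker_eq_bot']
    rintro ⟨v, hv⟩ h0
    obtain ⟨h1, h2, h3, h4⟩ := hB v hv
    have e0 := congrFun h0 0
    have e1 := congrFun h0 1
    have e2 := congrFun h0 2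
    have e3 := congrFun h0 3
    have e4 := congrFun h0 4
    simp [f] at e0 e1 e2 e3 e4
    have h22 : v 2 2 = 0 := by simpa [Matrix.trace_fin_three, e0, e1] using h4
    ext i j
    fin_cases i <;> fin_cases j <;> simp [*]
  simpa using LinearMap.finrank_le_finrank_of_injective hf

theorem sconj_swap (a b c d e f g h i : ℂ) :
    sconj ![1, 0, 2] !![a, b, c; d, e, f; g, h, i] =
      !![starRingEnd ℂ e, starRingEnd ℂ d, starRingEnd ℂ f;
         starRingEnd ℂ b, starRingEnd ℂ a, starRingEnd ℂ c;
         starRingEnd ℂ h, starRingEnd ℂ g, starRingEnd ℂ i] := by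
  ext i j; fin_cases i <;> fin_cases j <;> simp [sconj]

theorem star_mul_self_ne_neg_one (z : ℂ) : starRingEnd ℂ z * z ≠ -1 := by
  intro h
  have := congrArg Complex.re h
  rw [← Complex.normSq_eq_conj_mul_self, Complex.ofReal_re] at this
  have := Complex.normSq_nonneg z
  norm_num at *
  linarith

namespace IsHypercomplexPart

variable {V : Submodule ℂ (Matrix (Fin 3) (Fin 3) ℂ)}
  {ψ : Matrix (Fin 3) (Fin 3) ℂ → Matrix (Fin 3) (Fin 3) ℂ}

theorem sconj_sconj (M : Matrix (Fin 3) (Fin 3) ℂ) :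
    sconj ![1, 0, 2] (sconj ![1, 0, 2] M) = M := by
  ext i j; fin_cases i <;> fin_cases j <;> simp [sconj, -submatrix_cons_row]

theorem sconj_smul (σ : Fin 3 → Fin 3) (k : ℂ) (M : Matrix (Fin 3) (Fin 3) ℂ) :
    sconj σ (k • M) = starRingEnd ℂ k • sconj σ M := by
  ext i j; simp [sconj]

theorem cocycle_smul {σ : Fin 3 → Fin 3} (H : IsHypercomplexPart σ V ψ)
    {v w u : Matrix (Fin 3) (Fin 3) ℂ}
    (hv : v ∈ V) (hw : w ∈ V) (hu : u ∈ V) {k : ℂ} (h : v * w - w * v = k • u) :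
    k • sconj σ (ψ u) - (sconj σ (ψ v) * w - w * sconj σ (ψ v))
      - (v * sconj σ (ψ w) - sconj σ (ψ w) * v) ∈ V := by
  have := H.cocycle v hv w hw
  rwa [h, H.map_smul k u hu, sconj_smul, Complex.conj_conj] at this

theorem false_of_eigenvector (H : IsHypercomplexPart ![1, 0, 2] V ψ)
    {u : Matrix (Fin 3) (Fin 3) ℂ} (hu : u ∈ V) (hu0 : u ≠ 0) {k : ℂ}
    (h : sconj ![1, 0, 2] (ψ u) = k • sconj ![1, 0, 2] u) : False := by
  have h1 : ψ u = starRingEnd ℂ k • u := by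
    rw [← sconj_sconj (ψ u), h, sconj_smul, sconj_sconj]
  have h2 := H.map_map u hu
  rw [h1, H.map_smul _ u hu, h1, smul_smul, Complex.conj_conj] at h2
  have h3 : (k * starRingEnd ℂ k + 1) • u = 0 := by rw [add_smul, h2]; simp
  rcases smul_eq_zero.mp h3 with h4 | h4
  · exact star_mul_self_ne_neg_one k (by linear_combination h4)
  · exact hu0 h4

theorem conj_smul_sconj_map (H : IsHypercomplexPart ![1, 0, 2] V ψ)
    {u w : Matrix (Fin 3) (Fin 3) ℂ} (hu : u ∈ V) (hw : w ∈ V) {k : ℂ}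
    (h : sconj ![1, 0, 2] (ψ u) = k • sconj ![1, 0, 2] w) :
    starRingEnd ℂ k • sconj ![1, 0, 2] (ψ w) = - sconj ![1, 0, 2] u := by
  have h1 : ψ u = starRingEnd ℂ k • w := by
    rw [← sconj_sconj (ψ u), h, sconj_smul, sconj_sconj]
  have h2 := H.map_map u hu
  rw [h1, H.map_smul _ w hw, Complex.conj_conj] at h2
  rw [← sconj_smul, h2]
  ext i j; simp [sconj, -submatrix_cons_row]

theorem false_of_nilradical_le (H : IsHypercomplexPart ![1, 0, 2] V ψ)
    (h01 : !![0, 1, 0; 0, 0, 0; 0, 0, 0] ∈ V) (h02 : !![0, 0, 1; 0, 0, 0; 0, 0, 0] ∈ V)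
    (h21 : !![0, 0, 0; 0, 0, 0; 0, 1, 0] ∈ V) {a b c : ℂ} (habc : a + b + c = 0)
    (h0 : a ≠ 0 ∨ b ≠ 0)
    (hd : !![a, 0, 0; 0, b, 0; 0, 0, c] ∈ V) : False := by
  have repr : ∀ v ∈ V, ∃ t p q s : ℂ, v = !![t * a, p, q;
      0, t * b, 0; 0, s, t * c] := by
    intro v hv
    let B : Fin 4 → Matrix (Fin 3) (Fin 3) ℂ := ![!![a, 0, 0; 0, b, 0; 0, 0, c],
      !![0, 1, 0; 0, 0, 0; 0, 0, 0], !![0, 0, 1; 0, 0, 0; 0, 0, 0], !![0, 0, 0; 0, 0, 0; 0, 1, 0]]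
    have hB : ∀ i, B i ∈ V := by
      intro i; fin_cases i <;> simpa [B]
    have hli : LinearIndependent ℂ B := by
      rw [Fintype.linearIndependent_iff]
      intro g hg
      have e00 := congrFun (congrFun hg 0) 0
      have e11 := congrFun (congrFun hg 1) 1
      have e01 := congrFun (congrFun hg 0) 1
      have e02 := congrFun (congrFun hg 0) 2
      have e21 := congrFun (congrFun hg 2) 1
      simp [B, Fin.sum_univ_four] at e00 e11 e01 e02 e21
      have e0 : g 0 = 0 := by
        rcases h0 with h | h
        · exact e00.resolve_right h
        · exact e11.resolve_right h
      intro i; fin_cases i <;> assumption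
    obtain ⟨k, hk⟩ := exists_eq_sum_smul_of_linearIndependent H.finrank_eq hB hli hv
    refine ⟨k 0, k 1, k 2, k 3, ?_⟩
    rw [hk]
    ext i j
    fin_cases i <;> fin_cases j <;> simp [B, Fin.sum_univ_four]
  have mem : ∀ v ∈ V, v 1 0 = 0 ∧ v 2 0 = 0 ∧ v 1 2 = 0 ∧ v 0 0 * b = v 1 1 * a ∧
      v 1 1 * c = v 2 2 * b ∧ v 0 0 * c = v 2 2 * a := by
    intro v hv
    obtain ⟨t, p, q, s, rfl⟩ := repr v hv
    simp; refine ⟨?_, ?_, ?_⟩ <;> ring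
  have repr_map : ∀ v ∈ V, ∃ t p q s : ℂ, sconj ![1, 0, 2] (ψ v) =
      !![t * starRingEnd ℂ b, 0, 0; p, t * starRingEnd ℂ a, q;
        s, 0, t * starRingEnd ℂ c] := by
    intro v hv
    obtain ⟨t, p, q, s, h⟩ := repr _ (H.map_mem v hv)
    refine ⟨starRingEnd ℂ t, starRingEnd ℂ p, starRingEnd ℂ q, starRingEnd ℂ s, ?_⟩
    rw [h, sconj_swap]; simp
  obtain ⟨pt, pp, pq, ps, hp⟩ := repr_map _ h01
  obtain ⟨qt, qp, qq, qs, hq⟩ := repr_map _ h02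
  obtain ⟨st, sp, sq, ss, hs⟩ := repr_map _ h21
  obtain ⟨ut, up, uq, us, hu⟩ := repr_map _ hd
  have C1 := mem _ (H.cocycle_smul (k := a - b) hd h01 h01 (by
    ext i j; fin_cases i <;> fin_cases j <;> simp))
  have C2 := mem _ (H.cocycle_smul (k := a - c) hd h02 h02 (by
    ext i j; fin_cases i <;> fin_cases j <;> simp))
  have C3 := mem _ (H.cocycle_smul (k := c - b) hd h21 h21 (by
    ext i j; fin_cases i <;> fin_cases j <;> simp))
  have C4 := mem _ (H.cocycle_smul (k := 1) h02 h21 h01 (by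
    ext i j; fin_cases i <;> fin_cases j <;> simp))
  have C5 := mem _ (H.cocycle_smul (k := 0) h01 h02 h01 (by
    ext i j; fin_cases i <;> fin_cases j <;> simp))
  have C6 := mem _ (H.cocycle_smul (k := 0) h01 h21 h01 (by
    ext i j; fin_cases i <;> fin_cases j <;> simp))
  rw [hp, hu] at C1
  rw [hp, hq] at C5
  rw [hp, hs] at C6
  rw [hq, hu] at C2
  rw [hs, hu] at C3
  rw [hp, hq, hs] at C4
  simp at C1 C2 C3 C4 C5 C6
  obtain ⟨-, C1b, C1c, -⟩ := C1
  obtain ⟨C2a, C2b, C2c, C2d, C2e, C2f⟩ := C2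
  obtain ⟨C3a, C3b, C3c, C3d, C3e, C3f⟩ := C3
  obtain ⟨C4a, C4b, C4c, -⟩ := C4
  have hne : starRingEnd ℂ b * b = starRingEnd ℂ a * a → starRingEnd ℂ a * c = starRingEnd ℂ c * b →
      starRingEnd ℂ b * c = starRingEnd ℂ c * a → False := by
    intro e1 e2 e3
    have hk : ∃ k : ℂ, starRingEnd ℂ b = k * a ∧ starRingEnd ℂ a = k * b ∧
        starRingEnd ℂ c = k * c := by
      rcases h0 with h | h
      · refine ⟨starRingEnd ℂ b / a, ?_, ?_, ?_⟩ <;> field_simp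
        · linear_combination -e1
        · linear_combination -e3
      · refine ⟨starRingEnd ℂ a / b, ?_, ?_, ?_⟩ <;> field_simp
        · linear_combination e1
        · linear_combination -e2
    obtain ⟨k, k1, k2, k3⟩ := hk
    have := H.eq_zero_of_sconj_mem _ hd (by
      rw [sconj_swap]
      convert V.smul_mem k hd using 1
      ext i j; fin_cases i <;> fin_cases j <;> simp [*])
    rcases h0 with h | h
    · exact h (by simpa using congrFun (congrFun this 0) 0)
    · exact h (by simpa using congrFun (congrFun this 1) 1)
  obtain rfl : c = -a - b := by linear_combination habc
  have hps : ps = 0 := by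
    by_cases ha : a = 0
    · have hb : b ≠ 0 := by simpa [ha] using h0
      refine (mul_eq_zero.mp (?_ : (2 * b) * ps = 0)).resolve_left (by simpa)
      subst ha
      linear_combination C5.2.1 + b * C4b
    · refine (mul_eq_zero.mp (?_ : (3 * a) * ps = 0)).resolve_left (by simpa)
      linear_combination C1b
  have hpq : pq = 0 := by
    by_cases hb : b = 0
    · have ha : a ≠ 0 := by simpa [hb] using h0
      refine (mul_eq_zero.mp (?_ : (2 * a) * pq = 0)).resolve_left (by simpa)
      subst hb
      linear_combination C6.2.1 + a * C4c
    · refine (mul_eq_zero.mp (?_ : (3 * b) * pq = 0)).resolve_left (by simpa)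
      linear_combination -C1c
  subst C4a hps hpq
  simp only [zero_add] at C4b C4c
  subst C4b C4c
  have D := H.conj_smul_sconj_map h01 hd (k := pt) (by
    rw [hp, sconj_swap]; ext i j; fin_cases i <;> fin_cases j <;> simp)
  rw [hu, sconj_swap] at D
  have d1 := congrFun (congrFun D 1) 0
  have d2 := congrFun (congrFun D 1) 2
  have d3 := congrFun (congrFun D 2) 0
  simp at d1 d2 d3
  have hpt : pt ≠ 0 := by rintro rfl; simp at d1
  have huq : uq = 0 := d2.resolve_left hpt
  have hus : us = 0 := d3.resolve_left hpt
  have hup : up ≠ 0 := by rintro rfl; simp at d1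
  subst huq hus
  have hab : a - b ≠ 0 := by
    intro h
    refine hup ?_
    linear_combination -C2c + qq * h
  by_cases hac : a - (-a - b) = 0
  · have hcb : (-a - b) - b ≠ 0 := by
      intro h; exact hab (by linear_combination hac + h)
    have hsq : sq = 0 := by
      refine (mul_eq_zero.mp (?_ : (2 * ((-a - b) - b)) * sq = 0)).resolve_left (by simpa)
      linear_combination C3c
    have hst : st = 0 := by
      by_contra hst
      have hm : (-a - b - b) * st ≠ 0 := mul_ne_zero hcb hst
      refine hne ?_ ?_ ?_ <;> apply mul_left_cancel₀ hm
      · linear_combination C3d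
      · linear_combination C3e
      · linear_combination C3f
    refine H.false_of_eigenvector h21 ?_ (k := ss) ?_
    · intro h; simpa using congrFun (congrFun h 2) 1
    · rw [hs, sconj_swap]; ext i j; fin_cases i <;> fin_cases j <;> simp [*]
  · have hqs : qs = 0 := by
      refine (mul_eq_zero.mp (?_ : (2 * (a - (-a - b))) * qs = 0)).resolve_left (by simpa using hac)
      linear_combination C2b
    have hqt : qt = 0 := by
      by_contra hqt
      have hm : (a - (-a - b)) * qt ≠ 0 := mul_ne_zero hac hqt
      refine hne ?_ ?_ ?_ <;> apply mul_left_cancel₀ hm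
      · linear_combination C2d
      · linear_combination C2e
      · linear_combination C2f
    refine H.false_of_eigenvector h02 ?_ (k := qq) ?_
    · intro h; simpa using congrFun (congrFun h 0) 2
    · rw [hq, sconj_swap]; ext i j; fin_cases i <;> fin_cases j <;> simp [*]

theorem false_of_diagonal_shear (H : IsHypercomplexPart ![1, 0, 2] V ψ)
    (h01 : !![0, 1, 0; 0, 0, 0; 0, 0, 0] ∈ V) (h02 : !![0, 0, 1; 0, 0, 0; 0, 0, 0] ∈ V)
    {k : ℂ} (hd : !![2, 0, 0; 0, -1, 0; 0, 0, -1] ∈ V)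
    (hg : !![-1, 0, 0; 0, 1, 0; 0, k, 0] ∈ V) : False := by
  have h2 : starRingEnd ℂ 2 = 2 := map_ofNat _ 2
  have hk : k ≠ 0 := by
    rintro rfl
    have := H.eq_zero_of_sconj_mem _ hg (by
      rw [sconj_swap]
      convert V.neg_mem hg using 1
      ext i j; fin_cases i <;> fin_cases j <;> simp)
    simpa using congrFun (congrFun this 0) 0
  have repr : ∀ v ∈ V, ∃ t p q s : ℂ,
      v = !![2 * t - s, p, q; 0, s - t, 0; 0, s * k, -t] := by
    intro v hv
    let B : Fin 4 → Matrix (Fin 3) (Fin 3) ℂ := ![!![2, 0, 0; 0, -1, 0; 0, 0, -1],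
      !![0, 1, 0; 0, 0, 0; 0, 0, 0], !![0, 0, 1; 0, 0, 0; 0, 0, 0], !![-1, 0, 0; 0, 1, 0; 0, k, 0]]
    have hB : ∀ i, B i ∈ V := by
      intro i; fin_cases i <;> simpa [B]
    have hli : LinearIndependent ℂ B := by
      rw [Fintype.linearIndependent_iff]
      intro g hg
      have e22 := congrFun (congrFun hg 2) 2
      have e11 := congrFun (congrFun hg 1) 1
      have e01 := congrFun (congrFun hg 0) 1
      have e02 := congrFun (congrFun hg 0) 2
      simp [B, Fin.sum_univ_four] at e22 e11 e01 e02
      simp [e22] at e11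
      intro i; fin_cases i <;> assumption
    obtain ⟨c, hc⟩ := exists_eq_sum_smul_of_linearIndependent H.finrank_eq hB hli hv
    refine ⟨c 0, c 1, c 2, c 3, ?_⟩
    rw [hc]
    ext i j
    fin_cases i <;> fin_cases j <;> simp [B, Fin.sum_univ_four] <;> ring
  have mem : ∀ v ∈ V, v 1 0 = 0 ∧ v 2 0 = 0 ∧ v 1 2 = 0 ∧ v 2 1 = k * (v 1 1 - v 2 2) := by
    intro v hv
    obtain ⟨t, p, q, s, rfl⟩ := repr v hv
    simp; ring
  have repr_map : ∀ v ∈ V, ∃ t p q s : ℂ, sconj ![1, 0, 2] (ψ v) =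
      !![s - t, 0, 0; p, 2 * t - s, q; s * starRingEnd ℂ k, 0, -t] := by
    intro v hv
    obtain ⟨t, p, q, s, h⟩ := repr _ (H.map_mem v hv)
    refine ⟨starRingEnd ℂ t, starRingEnd ℂ p, starRingEnd ℂ q, starRingEnd ℂ s, ?_⟩
    rw [h, sconj_swap]; simp [h2]
  obtain ⟨pt, pp, pq, ps, hp⟩ := repr_map _ h01
  obtain ⟨qt, qp, qq, qs, hq⟩ := repr_map _ h02
  obtain ⟨ut, up, uq, us, hu⟩ := repr_map _ hd
  have C1 := mem _ (H.cocycle_smul (k := 3) hd h01 h01 (by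
    ext i j; fin_cases i <;> fin_cases j <;> simp; norm_num))
  have C2 := mem _ (H.cocycle_smul (k := 3) hd h02 h02 (by
    ext i j; fin_cases i <;> fin_cases j <;> simp; norm_num))
  rw [hp, hu] at C1
  rw [hq, hu] at C2
  simp at C1 C2
  ring_nf at C1 C2
  simp [hk] at C1
  obtain ⟨C1a, C1b, C1c, -⟩ := C1
  subst C1a C1b C1c
  have D := H.conj_smul_sconj_map h01 hd (k := pt) (by
    rw [hp, sconj_swap]; ext i j; fin_cases i <;> fin_cases j <;> simp [h2]; ring)
  rw [hu, sconj_swap] at D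
  have d1 := congrFun (congrFun D 1) 0
  have d2 := congrFun (congrFun D 1) 2
  have d3 := congrFun (congrFun D 2) 0
  have d4 := congrFun (congrFun D 2) 2
  simp at d1 d2 d3 d4
  have hpt : pt ≠ 0 := by rintro rfl; simp at d1
  simp [hpt, hk] at d2 d3 d4
  subst d2 d3 d4
  simp [hk] at C2
  obtain ⟨C2a, C2b, -, C2d⟩ := C2
  subst C2a C2b
  simp at C2d
  subst C2d
  refine H.false_of_eigenvector h02 ?_ (k := qq) ?_
  · intro h; simpa using congrFun (congrFun h 0) 2
  · rw [hq, sconj_swap]; ext i j; fin_cases i <;> fin_cases j <;> simp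

theorem false_of_parabolic (H : IsHypercomplexPart ![1, 0, 2] V ψ)
    (h01 : !![0, 1, 0; 0, 0, 0; 0, 0, 0] ∈ V) (h02 : !![0, 0, 1; 0, 0, 0; 0, 0, 0] ∈ V)
    (hV : ∀ v ∈ V, v 1 0 = 0 ∧ v 2 0 = 0 ∧ v 1 2 = 0) : False := by
  let B : Submodule ℂ (Matrix (Fin 3) (Fin 3) ℂ) :=
    { carrier := {v | v 1 0 = 0 ∧ v 2 0 = 0 ∧ v 1 2 = 0 ∧ v.trace = 0}
      add_mem' := by
        rintro v w ⟨h1, h2, h3, h4⟩ ⟨k1, k2, k3, k4⟩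
        simp [*]
      zero_mem' := by simp
      smul_mem' := by
        rintro r v ⟨h1, h2, h3, h4⟩
        simp [*] }
  have hVB : V ≤ B := fun v hv =>
    ⟨(hV v hv).1, (hV v hv).2.1, (hV v hv).2.2, H.trace_eq_zero v hv⟩
  have hB5 : Module.finrank ℂ B ≤ 5 := finrank_le_five_of_entries fun v hv => hv
  have hdB (a b c : ℂ) (h : a + b + c = 0) : !![a, 0, 0; 0, b, 0; 0, 0, c] ∈ B := by
    refine ⟨by simp, by simp, by simp, ?_⟩
    simpa [Matrix.trace_fin_three] using h
  by_cases h21 : !![0, 0, 0; 0, 0, 0; 0, 1, 0] ∈ V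
  · obtain ⟨s, t, hst, h⟩ := exists_smul_add_smul_mem H.finrank_eq hVB hB5
      (hdB 1 (-1) 0 (by ring)) (hdB 0 1 (-1) (by ring))
    refine H.false_of_nilradical_le h01 h02 h21 (a := s) (b := t - s) (c := -t) (by ring) ?_ ?_
    · by_cases hs : s = 0
      · simpa [hs] using hst
      · exact Or.inl hs
    · convert h using 1
      ext i j; fin_cases i <;> fin_cases j <;> simp; ring
  · have key (a b c : ℂ) (h : a + b + c = 0) : ∃ k, !![a, 0, 0; 0, b, 0; 0, k, c] ∈ V := by
      obtain ⟨s, t, hst, h⟩ := exists_smul_add_smul_mem H.finrank_eq hVB hB5 (hdB a b c h)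
        (show !![0, 0, 0; 0, 0, 0; 0, 1, 0] ∈ B by
          refine ⟨by simp, by simp, by simp, by simp [Matrix.trace_fin_three]⟩)
      have hs : s ≠ 0 := by
        rintro rfl
        have ht : t ≠ 0 := by simpa using hst
        refine h21 ((V.smul_mem_iff ht).mp (by simpa using h))
      refine ⟨t / s, ?_⟩
      rw [← V.smul_mem_iff hs]
      convert h using 1
      ext i j; fin_cases i <;> fin_cases j <;> simp; field_simp
    obtain ⟨τ, hτ⟩ := key 2 (-1) (-1) (by ring)
    obtain ⟨k, hk⟩ := key (-1) 1 0 (by ring)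
    have hτ0 : τ = 0 := by
      by_contra h
      refine h21 ((V.smul_mem_iff h).mp ?_)
      convert H.lie_mem _ hτ _ hk using 1
      ext i j; fin_cases i <;> fin_cases j <;> simp
    subst hτ0
    exact H.false_of_diagonal_shear h01 h02 hτ hk

end IsHypercomplexPart

/-- Conjugation by an invertible matrix `P` with inverse `Q`, as a linear automorphism. -/
def conjEquiv {P Q : Matrix (Fin 3) (Fin 3) ℂ} (hPQ : P * Q = 1) (hQP : Q * P = 1) :
    Matrix (Fin 3) (Fin 3) ℂ ≃ₗ[ℂ] Matrix (Fin 3) (Fin 3) ℂ where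
  toFun M := P * M * Q
  invFun M := Q * M * P
  map_add' M N := by simp [mul_add, add_mul]
  map_smul' r M := by simp
  left_inv M := by
    change Q * (P * M * Q) * P = M
    rw [show Q * (P * M * Q) * P = (Q * P) * M * (Q * P) by simp only [Matrix.mul_assoc], hQP]
    simp
  right_inv M := by
    change P * (Q * M * P) * Q = M
    rw [show P * (Q * M * P) * Q = (P * Q) * M * (P * Q) by simp only [Matrix.mul_assoc], hPQ]
    simp

@[simp] theorem conjEquiv_apply {P Q : Matrix (Fin 3) (Fin 3) ℂ} (hPQ : P * Q = 1)
    (hQP : Q * P = 1) (M : Matrix (Fin 3) (Fin 3) ℂ) : conjEquiv hPQ hQP M = P * M * Q := rfl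

@[simp] theorem conjEquiv_symm_apply {P Q : Matrix (Fin 3) (Fin 3) ℂ} (hPQ : P * Q = 1)
    (hQP : Q * P = 1) (M : Matrix (Fin 3) (Fin 3) ℂ) :
    (conjEquiv hPQ hQP).symm M = Q * M * P := rfl

theorem conjEquiv_mul {P Q : Matrix (Fin 3) (Fin 3) ℂ} (hPQ : P * Q = 1) (hQP : Q * P = 1)
    (M N : Matrix (Fin 3) (Fin 3) ℂ) :
    conjEquiv hPQ hQP (M * N) = conjEquiv hPQ hQP M * conjEquiv hPQ hQP N := by
  rw [conjEquiv_apply, conjEquiv_apply, conjEquiv_apply,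
    show P * M * Q * (P * N * Q) = P * M * (Q * P) * N * Q by simp only [Matrix.mul_assoc], hQP]
  simp [Matrix.mul_assoc]

theorem conjEquiv_trace {P Q : Matrix (Fin 3) (Fin 3) ℂ} (hPQ : P * Q = 1) (hQP : Q * P = 1)
    (M : Matrix (Fin 3) (Fin 3) ℂ) : (conjEquiv hPQ hQP M).trace = M.trace := by
  rw [conjEquiv_apply, Matrix.trace_mul_comm, ← Matrix.mul_assoc, hQP, Matrix.one_mul]

theorem conjEquiv_sconj {P Q : Matrix (Fin 3) (Fin 3) ℂ} (hPQ : P * Q = 1) (hQP : Q * P = 1)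
    {σ : Fin 3 → Fin 3} (hσ : Function.Involutive σ)
    (hP : P.map (starRingEnd ℂ) = P.submatrix id σ) (M : Matrix (Fin 3) (Fin 3) ℂ) :
    conjEquiv hPQ hQP (sconj σ M) = sconj id (conjEquiv hPQ hQP M) := by
  have e : P.map (starRingEnd ℂ) = P.submatrix id (hσ.toPerm) := hP
  have hP' : (P.map (starRingEnd ℂ)).submatrix id (hσ.toPerm) = P := by
    rw [e, Matrix.submatrix_submatrix]
    ext i j; simp [hσ j]
  have hQ' : (Q.map (starRingEnd ℂ)).submatrix (hσ.toPerm) id = Q := by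
    have h1 : (Q.map (starRingEnd ℂ)) * (P.map (starRingEnd ℂ)) = 1 := by
      rw [← Matrix.map_mul, hQP]; simp
    have h2 : (Q.map (starRingEnd ℂ)).submatrix (hσ.toPerm) id * P = 1 := by
      conv_lhs => rw [← hP']
      rw [← Matrix.submatrix_mul _ _ _ _ _ Function.bijective_id, h1]
      exact Matrix.submatrix_one_equiv hσ.toPerm
    calc _ = (Q.map (starRingEnd ℂ)).submatrix (hσ.toPerm) id * (P * Q) := by
          rw [hPQ, Matrix.mul_one]
      _ = Q := by rw [← Matrix.mul_assoc, h2, Matrix.one_mul]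
  have hQ : Q.map (starRingEnd ℂ) = Q.submatrix σ id := by
    conv_rhs => rw [← hQ']
    ext i j; simp [hσ i]
  have key : sconj id (P * M * Q) = P.submatrix id σ * M.map (starRingEnd ℂ) * Q.submatrix σ id := by
    simp [sconj, Matrix.map_mul, hP, hQ]
  rw [conjEquiv_apply, conjEquiv_apply, key, sconj]
  have s1 : M.map (starRingEnd ℂ) =
      ((M.map (starRingEnd ℂ)).submatrix σ σ).submatrix hσ.toPerm hσ.toPerm := by
    ext i j; simp [hσ i, hσ j]
  conv_rhs => rw [s1]
  change _ = P.submatrix id hσ.toPerm * _ * Q.submatrix hσ.toPerm id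
  rw [Matrix.submatrix_mul_equiv, Matrix.submatrix_mul_equiv, Matrix.submatrix_id_id]

namespace IsHypercomplexPart

variable {V : Submodule ℂ (Matrix (Fin 3) (Fin 3) ℂ)}
  {ψ : Matrix (Fin 3) (Fin 3) ℂ → Matrix (Fin 3) (Fin 3) ℂ}

theorem comap_conjEquiv (H : IsHypercomplexPart id V ψ)
    {P Q : Matrix (Fin 3) (Fin 3) ℂ} (hPQ : P * Q = 1) (hQP : Q * P = 1)
    {σ : Fin 3 → Fin 3} (hσ : Function.Involutive σ)
    (hP : P.map (starRingEnd ℂ) = P.submatrix id σ) :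
    IsHypercomplexPart σ (V.comap (conjEquiv hPQ hQP).toLinearMap)
      (fun M => (conjEquiv hPQ hQP).symm (ψ (conjEquiv hPQ hQP M))) where
  trace_eq_zero v hv := by
    rw [← conjEquiv_trace hPQ hQP]; exact H.trace_eq_zero _ hv
  lie_mem v hv w hw := by
    have := H.lie_mem _ hv _ hw
    simpa [Submodule.mem_comap, conjEquiv_mul, -conjEquiv_apply] using this
  finrank_eq := by
    rw [Submodule.comap_equiv_eq_map_symm, LinearEquiv.finrank_map_eq, H.finrank_eq]
  eq_zero_of_sconj_mem v hv hv' := by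
    have := H.eq_zero_of_sconj_mem _ hv (by
      simpa [Submodule.mem_comap, conjEquiv_sconj hPQ hQP hσ hP, -conjEquiv_apply] using hv')
    simpa [-conjEquiv_apply] using this
  exists_add M hM := by
    obtain ⟨v, hv, w, hw, h⟩ := H.exists_add (conjEquiv hPQ hQP M) (by rw [conjEquiv_trace, hM])
    refine ⟨(conjEquiv hPQ hQP).symm v, by simpa [-conjEquiv_apply, -conjEquiv_symm_apply],
      (conjEquiv hPQ hQP).symm w, by simpa [-conjEquiv_apply, -conjEquiv_symm_apply], ?_⟩
    apply (conjEquiv hPQ hQP).injective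
    rw [map_add, conjEquiv_sconj hPQ hQP hσ hP, h]
    simp [-conjEquiv_apply, -conjEquiv_symm_apply]
  map_mem v hv := by
    have := H.map_mem _ hv
    simpa [-conjEquiv_apply, -conjEquiv_symm_apply] using this
  map_smul a v hv := by
    have := H.map_smul a _ hv
    simp only [LinearEquiv.coe_coe] at this
    simp only [_root_.map_smul, this]
  map_map v hv := by
    have := H.map_map _ hv
    simp only [LinearEquiv.coe_coe] at this
    simp only [LinearEquiv.apply_symm_apply, this, map_neg, LinearEquiv.symm_apply_apply]
  cocycle v hv w hw := by
    have := H.cocycle _ hv _ hw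
    simp only [LinearEquiv.coe_coe] at this
    simp only [Submodule.mem_comap, LinearEquiv.coe_coe, map_sub, conjEquiv_mul,
      conjEquiv_sconj hPQ hQP hσ hP, LinearEquiv.apply_symm_apply]
    exact this

end IsHypercomplexPart

namespace IsHypercomplexPart

variable {V : Submodule ℂ (Matrix (Fin 3) (Fin 3) ℂ)}
  {ψ : Matrix (Fin 3) (Fin 3) ℂ → Matrix (Fin 3) (Fin 3) ℂ}

theorem sconj_transpose (σ : Fin 3 → Fin 3) (M : Matrix (Fin 3) (Fin 3) ℂ) :
    (sconj σ M)ᵀ = sconj σ Mᵀ := rfl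

theorem comap_transpose (H : IsHypercomplexPart id V ψ) :
    IsHypercomplexPart id
      (V.comap (Matrix.transposeLinearEquiv (Fin 3) (Fin 3) ℂ ℂ).toLinearMap)
      (fun M => (ψ Mᵀ)ᵀ) where
  trace_eq_zero v hv := by
    rw [← Matrix.trace_transpose]; exact H.trace_eq_zero _ hv
  lie_mem v hv w hw := by
    have := H.lie_mem _ hw _ hv
    simpa using this
  finrank_eq := by
    rw [Submodule.comap_equiv_eq_map_symm, LinearEquiv.finrank_map_eq, H.finrank_eq]
  eq_zero_of_sconj_mem v hv hv' := by
    have := H.eq_zero_of_sconj_mem _ hv (by simpa [sconj_transpose] using hv')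
    simpa using this
  exists_add M hM := by
    obtain ⟨v, hv, w, hw, h⟩ := H.exists_add Mᵀ (by rw [Matrix.trace_transpose, hM])
    refine ⟨vᵀ, by simpa, wᵀ, by simpa, ?_⟩
    rw [← Matrix.transpose_transpose M, h, Matrix.transpose_add, sconj_transpose]
  map_mem v hv := by simpa using H.map_mem _ hv
  map_smul a v hv := by
    rw [Matrix.transpose_smul, H.map_smul a vᵀ hv, Matrix.transpose_smul]
  map_map v hv := by
    rw [Matrix.transpose_transpose, H.map_map vᵀ hv, Matrix.transpose_neg,
      Matrix.transpose_transpose]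
  cocycle v hv w hw := by
    have := H.cocycle wᵀ hw vᵀ hv
    have key (A B C : Matrix (Fin 3) (Fin 3) ℂ) (h : (A - B - C)ᵀ ∈ V) : A - B - C ∈
      V.comap (Matrix.transposeLinearEquiv (Fin 3) (Fin 3) ℂ ℂ).toLinearMap := h
    apply key
    simp only [Matrix.transpose_sub, Matrix.transpose_mul, sconj_transpose,
      Matrix.transpose_transpose]
    rwa [sub_right_comm]

end IsHypercomplexPart

theorem exists_ne_zero_and_dotProduct_eq_zero (a b : Fin 3 → ℂ) :
    ∃ w : Fin 3 → ℂ, w ≠ 0 ∧ a ⬝ᵥ w = 0 ∧ b ⬝ᵥ w = 0 := by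
  obtain ⟨w, hw, h⟩ := (Matrix.exists_mulVec_eq_zero_iff (M := Matrix.of ![a, b, 0])).mpr
    (Matrix.det_eq_zero_of_row_eq_zero 2 (by simp))
  exact ⟨w, hw, congrFun h 0, congrFun h 1⟩

theorem exists_dotProduct_eq_one {a : Fin 3 → ℂ} (ha : a ≠ 0) :
    ∃ w : Fin 3 → ℂ, a ⬝ᵥ w = 1 := by
  obtain ⟨i, hi⟩ := Function.ne_iff.mp ha
  exact ⟨Pi.single i (a i)⁻¹, by rw [dotProduct_single, mul_inv_cancel₀ hi]⟩

theorem exists_frame {x ξ : Fin 3 → ℂ} (hx : x ≠ 0) (hξ : ξ ≠ 0) (h : ξ ⬝ᵥ x = 0) :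
    ∃ P Q : Matrix (Fin 3) (Fin 3) ℂ, P * Q = 1 ∧ Q * P = 1 ∧
      (∀ i, P i 0 = x i) ∧ ∀ j, Q 1 j = ξ j := by
  obtain ⟨y, hy⟩ := exists_dotProduct_eq_one hξ
  obtain ⟨η, hη⟩ := exists_dotProduct_eq_one hx
  rw [dotProduct_comm] at hη
  obtain ⟨z, hz, hz1, hz2⟩ := exists_ne_zero_and_dotProduct_eq_zero ξ η
  let P : Matrix (Fin 3) (Fin 3) ℂ := (Matrix.of ![x, y, z])ᵀ
  have hmul (c : Fin 3 → ℂ) : P *ᵥ c = c 0 • x + c 1 • y + c 2 • z := by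
    ext i; simp [P, Matrix.mulVec, dotProduct, Fin.sum_univ_three, mul_comm]
  have hdet : P.det ≠ 0 := by
    intro hdet
    obtain ⟨c, hc, hc0⟩ := Matrix.exists_mulVec_eq_zero_iff.mpr hdet
    rw [hmul] at hc0
    have h1 := congrArg (ξ ⬝ᵥ ·) hc0
    have h0 := congrArg (η ⬝ᵥ ·) hc0
    simp [dotProduct_add, h, hy, hz1] at h1
    simp [dotProduct_add, h1, hη, hz2] at h0
    simp [h0, h1, hz] at hc0
    exact hc (by ext i; fin_cases i <;> assumption)
  have hPQ : P * P⁻¹ = 1 := Matrix.mul_nonsing_inv _ hdet.isUnit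
  refine ⟨P, P⁻¹, hPQ, Matrix.nonsing_inv_mul _ hdet.isUnit, fun i => by simp [P], ?_⟩
  have h1 : ξ ᵥ* P = Pi.single 1 1 := by
    ext i; fin_cases i
    · simpa [P, Matrix.vecMul, Matrix.transpose] using h
    · simpa [P, Matrix.vecMul, Matrix.transpose] using hy
    · simpa [P, Matrix.vecMul, Matrix.transpose] using hz1
  intro j
  have h2 : ξ ᵥ* P ᵥ* P⁻¹ = ξ := by rw [Matrix.vecMul_vecMul, hPQ, Matrix.vecMul_one]
  rw [← h2, h1, Matrix.single_one_vecMul]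
  simp

/-- A four-dimensional Lie subalgebra of `sl(3,ℂ)`. -/
structure IsFourDimSubalgebra (V : Submodule ℂ (Matrix (Fin 3) (Fin 3) ℂ)) : Prop where
  trace_eq_zero : ∀ v ∈ V, v.trace = 0
  lie_mem : ∀ v ∈ V, ∀ w ∈ V, v * w - w * v ∈ V
  finrank_eq : Module.finrank ℂ V = 4

theorem IsFourDimSubalgebra.comap_conjEquiv {V : Submodule ℂ (Matrix (Fin 3) (Fin 3) ℂ)}
    (H : IsFourDimSubalgebra V) {P Q : Matrix (Fin 3) (Fin 3) ℂ}
    (hPQ : P * Q = 1) (hQP : Q * P = 1) :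
    IsFourDimSubalgebra (V.comap (conjEquiv hPQ hQP).toLinearMap) where
  trace_eq_zero v hv := by
    rw [← conjEquiv_trace hPQ hQP]; exact H.trace_eq_zero _ hv
  lie_mem v hv w hw := by
    have := H.lie_mem _ hv _ hw
    simpa [Submodule.mem_comap, conjEquiv_mul, -conjEquiv_apply] using this
  finrank_eq := by
    rw [Submodule.comap_equiv_eq_map_symm, LinearEquiv.finrank_map_eq, H.finrank_eq]

theorem IsHypercomplexPart.isFourDimSubalgebra {V : Submodule ℂ (Matrix (Fin 3) (Fin 3) ℂ)}
    {ψ : Matrix (Fin 3) (Fin 3) ℂ → Matrix (Fin 3) (Fin 3) ℂ} {σ : Fin 3 → Fin 3}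
    (H : IsHypercomplexPart σ V ψ) : IsFourDimSubalgebra V :=
  ⟨H.trace_eq_zero, H.lie_mem, H.finrank_eq⟩

theorem IsHypercomplexPart.false_of_centralizer {V : Submodule ℂ (Matrix (Fin 3) (Fin 3) ℂ)}
    {ψ : Matrix (Fin 3) (Fin 3) ℂ → Matrix (Fin 3) (Fin 3) ℂ}
    (H : IsHypercomplexPart id V ψ) {v η : Fin 3 → ℂ}
    (h : ∀ M : Matrix (Fin 3) (Fin 3) ℂ, M.trace = 0 →
      M * vecMulVec v η = vecMulVec v η * M → M ∈ V) : False := by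
  obtain ⟨w, hw, hw1, hw2⟩ := exists_ne_zero_and_dotProduct_eq_zero η (star η)
  obtain ⟨ω, hω, hω1, hω2⟩ := exists_ne_zero_and_dotProduct_eq_zero v (star v)
  have key (w ω : Fin 3 → ℂ) (h1 : η ⬝ᵥ w = 0) (h2 : v ⬝ᵥ ω = 0) :
      vecMulVec w ω - (ω ⬝ᵥ w / 3) • (1 : Matrix (Fin 3) (Fin 3) ℂ) ∈ V := by
    apply h
    · rw [Matrix.trace_sub, Matrix.trace_vecMulVec, Matrix.trace_smul, Matrix.trace_one,
        dotProduct_comm w]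
      simp
    · rw [Matrix.sub_mul, Matrix.mul_sub, Matrix.vecMulVec_mul_vecMulVec,
        Matrix.vecMulVec_mul_vecMulVec, h1, dotProduct_comm ω, h2]
      simp
  have h3 := H.eq_zero_of_sconj_mem _ (key w ω hw1 hω1) (by
    have h4 := key (star w) (star ω) 
      (by simpa [dotProduct, Fin.sum_univ_three] using congrArg (starRingEnd ℂ) hw2)
      (by simpa [dotProduct, Fin.sum_univ_three] using congrArg (starRingEnd ℂ) hω2)
    convert h4 using 1
    ext i j
    simp [sconj, vecMulVec_apply, dotProduct, Matrix.one_apply, apply_ite (starRingEnd ℂ),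
      map_ofNat (starRingEnd ℂ) 3])
  have h4 (i j : Fin 3) (hij : i ≠ j) : w i * ω j = 0 := by
    simpa [vecMulVec_apply, hij] using congrFun (congrFun h3 i) j
  have h5 (i : Fin 3) : w i * ω i = ω ⬝ᵥ w / 3 := by
    simpa [vecMulVec_apply, sub_eq_zero] using congrFun (congrFun h3 i) i
  obtain ⟨i, hi⟩ := Function.ne_iff.mp hw
  have h6 (j : Fin 3) (hij : i ≠ j) : ω j = 0 := (mul_eq_zero.mp (h4 i j hij)).resolve_left hi
  obtain ⟨j, hij⟩ := exists_ne i
  have h7 := (h5 i).trans (h5 j).symm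
  rw [h6 j hij.symm, mul_zero] at h7
  refine hω (funext fun k => ?_)
  by_cases hk : i = k
  · exact hk ▸ (mul_eq_zero.mp h7).resolve_left hi
  · exact h6 k hk

namespace IsFourDimSubalgebra

variable {V : Submodule ℂ (Matrix (Fin 3) (Fin 3) ℂ)}

theorem mem_of_block (H : IsFourDimSubalgebra V)
    (hV : ∀ v ∈ V, v 0 2 = 0 ∧ v 1 2 = 0 ∧ v 2 0 = 0 ∧ v 2 1 = 0)
    {M : Matrix (Fin 3) (Fin 3) ℂ} (hM : M 0 2 = 0 ∧ M 1 2 = 0 ∧ M 2 0 = 0 ∧ M 2 1 = 0)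
    (htr : M.trace = 0) : M ∈ V := by
  let B : Submodule ℂ (Matrix (Fin 3) (Fin 3) ℂ) :=
    { carrier := {v | v 0 2 = 0 ∧ v 1 2 = 0 ∧ v 2 0 = 0 ∧ v 2 1 = 0 ∧ v.trace = 0}
      add_mem' := by
        rintro v w ⟨h1, h2, h3, h4, h5⟩ ⟨k1, k2, k3, k4, k5⟩
        simp [*]
      zero_mem' := by simp
      smul_mem' := by
        rintro r v ⟨h1, h2, h3, h4, h5⟩
        simp [*] }
  have hVB : V ≤ B := fun v hv =>
    ⟨(hV v hv).1, (hV v hv).2.1, (hV v hv).2.2.1, (hV v hv).2.2.2, H.trace_eq_zero v hv⟩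
  let f : B →ₗ[ℂ] (Fin 4 → ℂ) :=
    { toFun := fun v => ![v.1 0 0, v.1 1 1, v.1 0 1, v.1 1 0]
      map_add' := by intro v w; ext i; fin_cases i <;> simp
      map_smul' := by intro r v; ext i; fin_cases i <;> simp }
  have hf : Function.Injective f := by
    rw [← LinearMap.ker_eq_bot, LinearMap.ker_eq_bot']
    rintro ⟨v, hv⟩ h0
    obtain ⟨h1, h2, h3, h4, h5⟩ := hv
    have e0 := congrFun h0 0
    have e1 := congrFun h0 1
    have e2 := congrFun h0 2
    have e3 := congrFun h0 3
    simp [f] at e0 e1 e2 e3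
    have h22 : v 2 2 = 0 := by simpa [Matrix.trace_fin_three, e0, e1] using h5
    ext i j
    fin_cases i <;> fin_cases j <;> simp [*]
  have hB := LinearMap.finrank_le_finrank_of_injective hf
  rw [Submodule.eq_of_le_of_finrank_le hVB (by rw [H.finrank_eq]; simpa using hB)]
  exact ⟨hM.1, hM.2.1, hM.2.2.1, hM.2.2.2, htr⟩

theorem eq_zero_of_sl_two_mem (H : IsFourDimSubalgebra V)
    (h01 : !![0, 1, 0; 0, 0, 0; 0, 0, 0] ∈ V) (h10 : !![0, 0, 0; 1, 0, 0; 0, 0, 0] ∈ V)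
    (hd : !![1, 0, 0; 0, -1, 0; 0, 0, 0] ∈ V) :
    (∀ a b : ℂ, !![0, 0, a; 0, 0, 0; 0, b, 0] ∈ V → a = 0 ∧ b = 0) ∧
    (∀ a b : ℂ, !![0, 0, 0; 0, 0, a; b, 0, 0] ∈ V → a = 0 ∧ b = 0) := by
  have key (a b c d : ℂ) (h : !![0, 0, a; 0, 0, b; c, d, 0] ∈ V)
      (h0 : a ≠ 0 ∨ b ≠ 0 ∨ c ≠ 0 ∨ d ≠ 0)
      (a' b' c' d' : ℂ) (h' : !![0, 0, a'; 0, 0, b'; c', d', 0] ∈ V) :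
      ∃ k, a' = k * a ∧ b' = k * b ∧ c' = k * c ∧ d' = k * d := by
    let B : Fin 4 → Matrix (Fin 3) (Fin 3) ℂ := ![!![0, 1, 0; 0, 0, 0; 0, 0, 0],
      !![0, 0, 0; 1, 0, 0; 0, 0, 0], !![1, 0, 0; 0, -1, 0; 0, 0, 0],
      !![0, 0, a; 0, 0, b; c, d, 0]]
    have hB : ∀ i, B i ∈ V := by
      intro i; fin_cases i <;> simpa [B]
    have hli : LinearIndependent ℂ B := by
      rw [Fintype.linearIndependent_iff]
      intro g hg
      have e00 := congrFun (congrFun hg 0) 0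
      have e01 := congrFun (congrFun hg 0) 1
      have e10 := congrFun (congrFun hg 1) 0
      have e02 := congrFun (congrFun hg 0) 2
      have e12 := congrFun (congrFun hg 1) 2
      have e20 := congrFun (congrFun hg 2) 0
      have e21 := congrFun (congrFun hg 2) 1
      simp [B, Fin.sum_univ_four] at e00 e01 e10 e02 e12 e20 e21
      have e3 : g 3 = 0 := by grind
      intro i; fin_cases i <;> assumption
    obtain ⟨k, hk⟩ := exists_eq_sum_smul_of_linearIndependent H.finrank_eq hB hli h'
    have e02 := congrFun (congrFun hk 0) 2
    have e12 := congrFun (congrFun hk 1) 2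
    have e20 := congrFun (congrFun hk 2) 0
    have e21 := congrFun (congrFun hk 2) 1
    simp [B, Fin.sum_univ_four] at e02 e12 e20 e21
    exact ⟨k 3, e02, e12, e20, e21⟩
  constructor
  · intro a b h
    by_contra h0
    have hb : !![0, 0, 0; 0, 0, a; -b, 0, 0] ∈ V := by
      convert H.lie_mem _ h10 _ h using 1
      ext i j; fin_cases i <;> fin_cases j <;> simp
    obtain ⟨k, hk⟩ := key a 0 0 b h (by grind) 0 a (-b) 0 hb
    grind
  · intro a b h
    by_contra h0
    have hb : !![0, 0, a; 0, 0, 0; 0, -b, 0] ∈ V := by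
      convert H.lie_mem _ h01 _ h using 1
      ext i j; fin_cases i <;> fin_cases j <;> simp
    obtain ⟨k, hk⟩ := key 0 a b 0 h (by grind) a 0 0 (-b) hb
    grind

theorem mem_of_sl_two (H : IsFourDimSubalgebra V)
    (h01 : !![0, 1, 0; 0, 0, 0; 0, 0, 0] ∈ V)
    (hd : !![1, 0, 0; 0, -1, 0; 0, 0, 0] ∈ V) {y : Matrix (Fin 3) (Fin 3) ℂ} (hy : y ∈ V)
    (hy0 : y 1 0 ≠ 0) {M : Matrix (Fin 3) (Fin 3) ℂ}
    (hM : M 0 2 = 0 ∧ M 1 2 = 0 ∧ M 2 0 = 0 ∧ M 2 1 = 0)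
    (htr : M.trace = 0) : M ∈ V := by
  have had (v : Matrix (Fin 3) (Fin 3) ℂ) (hv : v ∈ V) :
      !![0, 2 * v 0 1, v 0 2; -2 * v 1 0, 0, -v 1 2; -v 2 0, v 2 1, 0] ∈ V := by
    convert H.lie_mem _ hd _ hv using 1
    ext i j; fin_cases i <;> fin_cases j <;>
      simp [Matrix.mul_apply, Matrix.vecMul, dotProduct, Fin.sum_univ_three] <;> ring
  have had2 (v : Matrix (Fin 3) (Fin 3) ℂ) (hv : v ∈ V) :
      !![0, 4 * v 0 1, v 0 2; 4 * v 1 0, 0, v 1 2; v 2 0, v 2 1, 0] ∈ V := by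
    convert had _ (had v hv) using 1
    ext i j; fin_cases i <;> fin_cases j <;> simp <;> ring
  have had3 (v : Matrix (Fin 3) (Fin 3) ℂ) (hv : v ∈ V) :
      !![0, 8 * v 0 1, v 0 2; -8 * v 1 0, 0, -v 1 2; -v 2 0, v 2 1, 0] ∈ V := by
    convert had _ (had2 v hv) using 1
    ext i j; fin_cases i <;> fin_cases j <;> simp <;> ring
  have hsplit (v : Matrix (Fin 3) (Fin 3) ℂ) (hv : v ∈ V) :
      !![0, 0, v 0 2; 0, 0, 0; 0, v 2 1, 0] ∈ V ∧ !![0, 0, 0; 0, 0, v 1 2; v 2 0, 0, 0] ∈ V := by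
    have k1 : !![0, 0, v 0 2; 0, 0, -v 1 2; -v 2 0, v 2 1, 0] ∈ V := by
      convert V.smul_mem (1 / 3 : ℂ) (V.sub_mem (V.smul_mem (4 : ℂ) (had v hv)) (had3 v hv)) using 1
      ext i j; fin_cases i <;> fin_cases j <;> simp <;> ring
    have k2 := had _ k1
    constructor
    · convert V.smul_mem (1 / 2 : ℂ) (V.add_mem k2 k1) using 1
      ext i j; fin_cases i <;> fin_cases j <;> simp <;> ring
    · convert V.smul_mem (1 / 2 : ℂ) (V.sub_mem k2 k1) using 1
      ext i j; fin_cases i <;> fin_cases j <;> simp <;> ring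
  have h10 : !![0, 0, 0; 1, 0, 0; 0, 0, 0] ∈ V := by
    have k1 := V.sub_mem (had3 y hy) (had y hy)
    have k2 := V.smul_mem (-(6 * y 1 0)⁻¹) (V.sub_mem k1 (V.smul_mem (6 * y 0 1) h01))
    convert k2 using 1
    ext i j; fin_cases i <;> fin_cases j <;> simp <;> grind
  obtain ⟨k1, k2⟩ := H.eq_zero_of_sl_two_mem h01 h10 hd
  refine H.mem_of_block (fun v hv => ?_) hM htr
  obtain ⟨m1, m2⟩ := hsplit v hv
  exact ⟨(k1 _ _ m1).1, (k2 _ _ m2).1, (k2 _ _ m2).2, (k1 _ _ m1).2⟩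

end IsFourDimSubalgebra

theorem exists_centralizer_le_of_comap {V : Submodule ℂ (Matrix (Fin 3) (Fin 3) ℂ)}
    {P Q : Matrix (Fin 3) (Fin 3) ℂ} (hPQ : P * Q = 1) (hQP : Q * P = 1)
    (h : ∃ v η : Fin 3 → ℂ, ∀ M : Matrix (Fin 3) (Fin 3) ℂ, M.trace = 0 →
      M * vecMulVec v η = vecMulVec v η * M → M ∈ V.comap (conjEquiv hPQ hQP).toLinearMap) :
    ∃ v η : Fin 3 → ℂ, ∀ M : Matrix (Fin 3) (Fin 3) ℂ, M.trace = 0 →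
      M * vecMulVec v η = vecMulVec v η * M → M ∈ V := by
  obtain ⟨v, η, h⟩ := h
  refine ⟨P *ᵥ v, η ᵥ* Q, fun M hM hc => ?_⟩
  have hp : vecMulVec (P *ᵥ v) (η ᵥ* Q) = conjEquiv hPQ hQP (vecMulVec v η) := by
    rw [conjEquiv_apply, Matrix.mul_vecMulVec, Matrix.vecMulVec_mul]
  have := h ((conjEquiv hPQ hQP).symm M)
    (by rw [← conjEquiv_trace hPQ hQP, LinearEquiv.apply_symm_apply, hM])
    (by
      apply (conjEquiv hPQ hQP).injective
      rw [conjEquiv_mul, conjEquiv_mul, LinearEquiv.apply_symm_apply, ← hp, hc])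
  simpa [-conjEquiv_apply, -conjEquiv_symm_apply] using this

theorem IsFourDimSubalgebra.exists_centralizer_le {V : Submodule ℂ (Matrix (Fin 3) (Fin 3) ℂ)}
    (H : IsFourDimSubalgebra V) (h01 : !![0, 1, 0; 0, 0, 0; 0, 0, 0] ∈ V)
    {y : Matrix (Fin 3) (Fin 3) ℂ} (hy : y ∈ V) (hy0 : y 1 0 ≠ 0) :
    ∃ v η : Fin 3 → ℂ, ∀ M : Matrix (Fin 3) (Fin 3) ℂ, M.trace = 0 →
      M * vecMulVec v η = vecMulVec v η * M → M ∈ V := by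
  wlog h1 : y 1 0 = 1 generalizing y
  · exact this (V.smul_mem (y 1 0)⁻¹ hy) (by simp [hy0]) (by simp [hy0])
  obtain ⟨β, hβ⟩ : ∃ β, y 1 2 = β := ⟨_, rfl⟩
  obtain ⟨α, hα⟩ : ∃ α, y 1 1 - y 0 0 = α := ⟨_, rfl⟩
  obtain ⟨γ, hγ⟩ : ∃ γ, y 2 0 = -γ := ⟨-y 2 0, by simp⟩
  have hh : !![1, α, β; 0, -1, 0; 0, γ, 0] ∈ V := by
    convert H.lie_mem _ h01 _ hy using 1
    ext i j; fin_cases i <;> fin_cases j <;>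
      simp [Matrix.mul_apply, Matrix.vecMul, dotProduct, Fin.sum_univ_three, h1, hα, hβ, hγ]
  let P : Matrix (Fin 3) (Fin 3) ℂ := !![1, (β * γ - α) / 2, -β; 0, 1, 0; 0, -γ, 1]
  let Q : Matrix (Fin 3) (Fin 3) ℂ := !![1, (β * γ + α) / 2, β; 0, 1, 0; 0, γ, 1]
  have hPQ : P * Q = 1 := by
    ext i j; fin_cases i <;> fin_cases j <;> simp [P, Q]; ring
  have hQP : Q * P = 1 := by
    ext i j; fin_cases i <;> fin_cases j <;> simp [P, Q]; ring
  refine exists_centralizer_le_of_comap hPQ hQP ⟨![0, 0, 1], ![0, 0, 1], fun M hM hc => ?_⟩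
  refine (H.comap_conjEquiv hPQ hQP).mem_of_sl_two (y := Q * y * P) ?_ ?_ ?_ ?_ ?_ hM
  · rw [Submodule.mem_comap]
    convert h01 using 1
    ext i j; fin_cases i <;> fin_cases j <;> simp [P, Q]
  · rw [Submodule.mem_comap]
    convert hh using 1
    ext i j; fin_cases i <;> fin_cases j <;> simp [P, Q] <;> ring
  · rw [Submodule.mem_comap]
    convert hy using 1
    exact (conjEquiv hPQ hQP).apply_symm_apply y
  · simp [P, Q, Matrix.mul_apply, Matrix.vecMul, dotProduct, Fin.sum_univ_three, h1]
  · have e (i j : Fin 3) := congrFun (congrFun hc i) j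
    simp [Matrix.mul_apply, Fin.sum_univ_three] at e
    have e02 := e 0 2
    have e12 := e 1 2
    have e20 := e 2 0
    have e21 := e 2 1
    simp at e02 e12 e20 e21
    exact ⟨e02, e12, e20.symm, e21.symm⟩

theorem vecMulVec_eq_conjEquiv {P Q : Matrix (Fin 3) (Fin 3) ℂ} (hPQ : P * Q = 1)
    (hQP : Q * P = 1) {x ξ : Fin 3 → ℂ} (hx : ∀ i, P i 0 = x i) (hξ : ∀ j, Q 1 j = ξ j) :
    conjEquiv hPQ hQP !![0, 1, 0; 0, 0, 0; 0, 0, 0] = vecMulVec x ξ := by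
  ext i j
  simp [Matrix.mul_apply, Fin.sum_univ_three, vecMulVec_apply, ← hx, ← hξ]

theorem conjEquiv_symm_one_zero {P Q : Matrix (Fin 3) (Fin 3) ℂ} (hPQ : P * Q = 1)
    (hQP : Q * P = 1) {x ξ : Fin 3 → ℂ} (hx : ∀ i, P i 0 = x i) (hξ : ∀ j, Q 1 j = ξ j)
    (y : Matrix (Fin 3) (Fin 3) ℂ) :
    (conjEquiv hPQ hQP).symm y 1 0 = ξ ⬝ᵥ (y *ᵥ x) := by
  simp [Matrix.mul_apply, Fin.sum_univ_three, dotProduct, mulVec, ← hx, ← hξ]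
  ring

theorem IsHypercomplexPart.dotProduct_mulVec_eq_zero
    {V : Submodule ℂ (Matrix (Fin 3) (Fin 3) ℂ)}
    {ψ : Matrix (Fin 3) (Fin 3) ℂ → Matrix (Fin 3) (Fin 3) ℂ}
    (H : IsHypercomplexPart id V ψ) {x ξ : Fin 3 → ℂ} (hx : x ≠ 0) (hξ : ξ ≠ 0)
    (h : ξ ⬝ᵥ x = 0) (hV : vecMulVec x ξ ∈ V) {y : Matrix (Fin 3) (Fin 3) ℂ} (hy : y ∈ V) :
    ξ ⬝ᵥ (y *ᵥ x) = 0 := by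
  by_contra h0
  obtain ⟨P, Q, hPQ, hQP, hP, hQ⟩ := exists_frame hx hξ h
  have h1 := (H.isFourDimSubalgebra.comap_conjEquiv hPQ hQP).exists_centralizer_le
    (y := (conjEquiv hPQ hQP).symm y)
    (by rwa [Submodule.mem_comap, LinearEquiv.coe_coe, vecMulVec_eq_conjEquiv hPQ hQP hP hQ])
    (by rwa [Submodule.mem_comap, LinearEquiv.coe_coe, LinearEquiv.apply_symm_apply])
    (by rwa [conjEquiv_symm_one_zero hPQ hQP hP hQ])
  obtain ⟨v, η, h2⟩ := exists_centralizer_le_of_comap hPQ hQP h1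
  exact H.false_of_centralizer h2

namespace IsFourDimSubalgebra

variable {V : Submodule ℂ (Matrix (Fin 3) (Fin 3) ℂ)}

theorem forall_eq_zero_or_forall_eq_zero (H : IsFourDimSubalgebra V)
    (h01 : !![0, 1, 0; 0, 0, 0; 0, 0, 0] ∈ V) (hV : ∀ v ∈ V, v 1 0 = 0) :
    (∀ v ∈ V, v 2 0 = 0) ∨ (∀ v ∈ V, v 1 2 = 0) := by
  by_contra! h0
  obtain ⟨⟨y, hy, hy0⟩, ⟨z, hz, hz0⟩⟩ := h0
  wlog h1 : y 2 0 = 1 generalizing y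
  · exact this _ (V.smul_mem (y 2 0)⁻¹ hy) (by simp [hy0]) (by simp [hy0])
  obtain ⟨c, hc⟩ : ∃ c, y 1 2 = c := ⟨_, rfl⟩
  have hc0 : c ≠ 0 := by
    have := hV _ (H.lie_mem _ hy _ hz)
    simp [Matrix.mul_apply, Fin.sum_univ_three, hV y hy, hV z hz, h1, hc] at this
    rintro rfl
    simp at this
    exact hz0 this
  have hprop (v : Matrix (Fin 3) (Fin 3) ℂ) (hv : v ∈ V) : v 1 2 = c * v 2 0 := by
    have := hV _ (H.lie_mem _ hy _ hv)
    simp [Matrix.mul_apply, Fin.sum_univ_three, hV y hy, hV v hv, h1, hc] at this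
    linear_combination -this
  have g1 : !![0, 0, c; 0, 0, 0; 0, -1, 0] ∈ V := by
    convert V.sub_mem (H.lie_mem _ h01 _ hy) (V.smul_mem (y 1 1 - y 0 0) h01) using 1
    ext i j; fin_cases i <;> fin_cases j <;>
      simp [Matrix.mul_apply, Matrix.vecMul, dotProduct, Fin.sum_univ_three, h1, hc, hV y hy]
  have h3 := hprop _ (H.lie_mem _ (H.lie_mem _ g1 _ hy) _ hy)
  simp [Matrix.mul_apply, Matrix.vecMul, dotProduct, Fin.sum_univ_three, h1, hc, hV y hy] at h3
  have h4 : c ^ 2 = 0 := by linear_combination h3 / 6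
  exact hc0 (by simpa using h4)

theorem parabolic (H : IsFourDimSubalgebra V)
    (h01 : !![0, 1, 0; 0, 0, 0; 0, 0, 0] ∈ V) (hV : ∀ v ∈ V, v 1 0 = 0) :
    ((∀ v ∈ V, v 2 0 = 0) ∧ !![0, 0, 1; 0, 0, 0; 0, 0, 0] ∈ V) ∨
    ((∀ v ∈ V, v 1 2 = 0) ∧ !![0, 0, 0; 0, 0, 0; 0, 1, 0] ∈ V) := by
  have hbr (y : Matrix (Fin 3) (Fin 3) ℂ) (hy : y ∈ V) :
      !![0, 0, y 1 2; 0, 0, 0; 0, -y 2 0, 0] ∈ V := by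
    convert V.sub_mem (H.lie_mem _ h01 _ hy) (V.smul_mem (y 1 1 - y 0 0) h01) using 1
    ext i j; fin_cases i <;> fin_cases j <;>
      simp [Matrix.mul_apply, Matrix.vecMul, dotProduct, Fin.sum_univ_three, hV y hy]
  have scale02 (a : ℂ) (ha : a ≠ 0) (h : !![0, 0, a; 0, 0, 0; 0, 0, 0] ∈ V) :
      !![0, 0, 1; 0, 0, 0; 0, 0, 0] ∈ V := by
    convert V.smul_mem a⁻¹ h using 1
    ext i j; fin_cases i <;> fin_cases j <;> simp [ha]
  have scale21 (a : ℂ) (ha : a ≠ 0) (h : !![0, 0, 0; 0, 0, 0; 0, a, 0] ∈ V) :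
      !![0, 0, 0; 0, 0, 0; 0, 1, 0] ∈ V := by
    convert V.smul_mem a⁻¹ h using 1
    ext i j; fin_cases i <;> fin_cases j <;> simp [ha]
  by_cases h20 : ∀ v ∈ V, v 2 0 = 0
  swap
  · have h12 := (H.forall_eq_zero_or_forall_eq_zero h01 hV).resolve_left h20
    push Not at h20
    obtain ⟨y, hy, hy0⟩ := h20
    refine Or.inr ⟨h12, scale21 (-y 2 0) (neg_ne_zero.mpr hy0) ?_⟩
    simpa [h12 y hy] using hbr y hy
  by_cases h12 : ∀ v ∈ V, v 1 2 = 0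
  swap
  · push Not at h12
    obtain ⟨y, hy, hy0⟩ := h12
    refine Or.inl ⟨h20, scale02 (y 1 2) hy0 ?_⟩
    simpa [h20 y hy] using hbr y hy
  suffices !![0, 0, 1; 0, 0, 0; 0, 0, 0] ∈ V ∨ !![0, 0, 0; 0, 0, 0; 0, 1, 0] ∈ V from
    this.imp (fun h => ⟨h20, h⟩) fun h => ⟨h12, h⟩
  let B : Submodule ℂ (Matrix (Fin 3) (Fin 3) ℂ) :=
    { carrier := {v | v 1 0 = 0 ∧ v 2 0 = 0 ∧ v 1 2 = 0 ∧ v.trace = 0}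
      add_mem' := by
        rintro v w ⟨h1, h2, h3, h4⟩ ⟨k1, k2, k3, k4⟩
        simp [*]
      zero_mem' := by simp
      smul_mem' := by
        rintro r v ⟨h1, h2, h3, h4⟩
        simp [*] }
  have hVB : V ≤ B := fun v hv => ⟨hV v hv, h20 v hv, h12 v hv, H.trace_eq_zero v hv⟩
  have hB5 : Module.finrank ℂ B ≤ 5 := finrank_le_five_of_entries fun v hv => hv
  have hb02 : !![0, 0, 1; 0, 0, 0; 0, 0, 0] ∈ B := by
    refine ⟨by simp, by simp, by simp, by simp [Matrix.trace_fin_three]⟩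
  have hb21 : !![0, 0, 0; 0, 0, 0; 0, 1, 0] ∈ B := by
    refine ⟨by simp, by simp, by simp, by simp [Matrix.trace_fin_three]⟩
  have hbd : !![1, 0, 0; 0, 0, 0; 0, 0, -1] ∈ B := by
    refine ⟨by simp, by simp, by simp, by simp [Matrix.trace_fin_three]⟩
  obtain ⟨s, t, hst, h⟩ := exists_smul_add_smul_mem H.finrank_eq hVB hB5 hb02 hb21
  obtain ⟨p, q, hpq, h'⟩ := exists_smul_add_smul_mem H.finrank_eq hVB hB5 hbd hb02
  by_cases hp : p = 0
  · have hq : q ≠ 0 := by simpa [hp] using hpq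
    left
    refine scale02 q hq ?_
    convert h' using 1
    ext i j; fin_cases i <;> fin_cases j <;> simp [hp]
  by_cases ht : t = 0
  · have hs : s ≠ 0 := by simpa [ht] using hst
    left
    refine scale02 s hs ?_
    convert h using 1
    ext i j; fin_cases i <;> fin_cases j <;> simp [ht]
  right
  refine scale21 (-3 * p * t) (by simp [hp, ht]) ?_
  convert V.sub_mem (V.sub_mem (H.lie_mem _ h' _ h) (V.smul_mem (q * t) h01))
    (V.smul_mem (2 * p) h) using 1
  ext i j; fin_cases i <;> fin_cases j <;> simp <;> ring

end IsFourDimSubalgebra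

theorem exists_eq_smul_of_mul_eq {a b c d : ℂ} (h : a * d - b * c = 0) (h0 : ![a, b] ≠ 0) :
    ∃ k : ℂ, ![c, d] = k • ![a, b] := by
  by_cases ha : a = 0
  · have hb : b ≠ 0 := by rintro rfl; exact h0 (by simp [ha])
    refine ⟨d / b, ?_⟩
    have hc : c = 0 := by simpa [ha, hb] using h
    ext i; fin_cases i <;> simp [ha, hb, hc]
  · refine ⟨c / a, ?_⟩
    ext i; fin_cases i <;> simp [ha]
    field_simp
    linear_combination h

theorem exists_eq_smul_of_vecMul_eq_zero {N : Matrix (Fin 2) (Fin 2) ℂ} (hN : N ≠ 0)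
    {η ζ : Fin 2 → ℂ} (hη : η ≠ 0) (h1 : η ᵥ* N = 0) (h2 : ζ ᵥ* N = 0) :
    ∃ k : ℂ, ζ = k • η := by
  have h : η 0 * ζ 1 - η 1 * ζ 0 = 0 := by
    by_contra h
    apply hN
    have e1 := congrFun h1 0
    have e2 := congrFun h1 1
    have e3 := congrFun h2 0
    have e4 := congrFun h2 1
    simp [Matrix.vecMul, dotProduct] at e1 e2 e3 e4
    have f1 : N 0 0 = 0 := by
      refine (mul_eq_zero.mp (?_ : (η 0 * ζ 1 - η 1 * ζ 0) * N 0 0 = 0)).resolve_left h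
      linear_combination ζ 1 * e1 - η 1 * e3
    have f2 : N 0 1 = 0 := by
      refine (mul_eq_zero.mp (?_ : (η 0 * ζ 1 - η 1 * ζ 0) * N 0 1 = 0)).resolve_left h
      linear_combination ζ 1 * e2 - η 1 * e4
    have f3 : N 1 0 = 0 := by
      refine (mul_eq_zero.mp (?_ : (η 0 * ζ 1 - η 1 * ζ 0) * N 1 0 = 0)).resolve_left h
      linear_combination η 0 * e3 - ζ 0 * e1
    have f4 : N 1 1 = 0 := by
      refine (mul_eq_zero.mp (?_ : (η 0 * ζ 1 - η 1 * ζ 0) * N 1 1 = 0)).resolve_left h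
      linear_combination η 0 * e4 - ζ 0 * e2
    ext i j
    fin_cases i <;> fin_cases j <;> assumption
  have e (v : Fin 2 → ℂ) : ![v 0, v 1] = v := by ext i; fin_cases i <;> rfl
  simpa [e] using exists_eq_smul_of_mul_eq h (by simpa [e])

theorem exists_vecMul_eq_smul (A : Matrix (Fin 2) (Fin 2) ℂ) :
    ∃ η : Fin 2 → ℂ, η ≠ 0 ∧ ∃ a : ℂ, η ᵥ* A = a • η := by
  obtain ⟨a, ha⟩ := Module.End.exists_eigenvalue (Matrix.vecMulLinear A)
  obtain ⟨η, h⟩ := ha.exists_hasEigenvector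
  exact ⟨η, h.2, a, h.apply_eq_smul⟩

theorem exists_common_eigenvector {A B : Matrix (Fin 2) (Fin 2) ℂ} {α β : ℂ}
    (h : A * B - B * A = α • A + β • B) :
    ∃ η : Fin 2 → ℂ, η ≠ 0 ∧ (∃ a : ℂ, η ᵥ* A = a • η) ∧ ∃ b : ℂ, η ᵥ* B = b • η := by
  by_cases hC : A * B - B * A = 0
  · by_cases hA : ∃ a : ℂ, A = a • 1
    · obtain ⟨a, rfl⟩ := hA
      obtain ⟨η, hη, hb⟩ := exists_vecMul_eq_smul B
      exact ⟨η, hη, ⟨a, by simp [Matrix.vecMul_smul]⟩, hb⟩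
    · push Not at hA
      obtain ⟨η, hη, a, ha⟩ := exists_vecMul_eq_smul A
      refine ⟨η, hη, ⟨a, ha⟩, ?_⟩
      refine exists_eq_smul_of_vecMul_eq_zero (N := A - a • 1) (sub_ne_zero.mpr (hA a)) hη ?_ ?_
      · rw [Matrix.vecMul_sub, ha, Matrix.vecMul_smul, Matrix.vecMul_one, sub_self]
      · rw [Matrix.vecMul_vecMul, Matrix.mul_sub, ← sub_eq_zero.mp hC, Matrix.vecMul_sub,
          ← Matrix.vecMul_vecMul, ha]
        simp [Matrix.vecMul_smul, Matrix.smul_vecMul]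
  · obtain ⟨C, hCdef⟩ : ∃ C, A * B - B * A = C := ⟨_, rfl⟩
    have hC' : C = α • A + β • B := hCdef ▸ h
    have hAC : A * C = C * A + β • C := by
      have : A * C - C * A = β • (A * B - B * A) := by
        rw [hC']
        simp only [Matrix.mul_add, Matrix.add_mul, Matrix.mul_smul, Matrix.smul_mul, smul_sub]
        abel
      rw [hCdef] at this
      rw [← this]; abel
    have hBC : B * C = C * B + (-α) • C := by
      have : B * C - C * B = (-α) • (A * B - B * A) := by
        rw [hC']
        simp only [Matrix.mul_add, Matrix.add_mul, Matrix.mul_smul, Matrix.smul_mul, smul_sub,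
          neg_smul]
        abel
      rw [hCdef] at this
      rw [← this]; abel
    have htr : C.trace = 0 := by
      rw [← hCdef, Matrix.trace_sub, Matrix.trace_mul_comm, sub_self]
    have htr2 : (C * C).trace = 0 := by
      have : C * C = α • (A * C) + β • (B * C) := by
        conv_lhs => enter [1]; rw [← hCdef, h]
        simp [Matrix.add_mul]
      rw [this, ← hCdef]
      simp only [Matrix.mul_sub, Matrix.trace_add, Matrix.trace_smul, Matrix.trace_sub]
      rw [← Matrix.mul_assoc A B A, Matrix.trace_mul_comm (A * B) A,
        ← Matrix.mul_assoc B A B, Matrix.trace_mul_comm (B * A) B]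
      simp
    have hdet : C.det = 0 := by
      rw [Matrix.trace_fin_two] at htr htr2
      simp [Matrix.mul_apply] at htr2
      rw [Matrix.det_fin_two]
      linear_combination (C 0 0 + C 1 1) * htr / 2 - htr2 / 2
    obtain ⟨η, hη, hη0⟩ := Matrix.exists_vecMul_eq_zero_iff.mpr hdet
    have hC0 : C ≠ 0 := hCdef ▸ hC
    refine ⟨η, hη, exists_eq_smul_of_vecMul_eq_zero hC0 hη hη0 ?_,
      exists_eq_smul_of_vecMul_eq_zero hC0 hη hη0 ?_⟩
    · rw [Matrix.vecMul_vecMul, hAC, Matrix.vecMul_add, ← Matrix.vecMul_vecMul, hη0]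
      simp [Matrix.vecMul_smul, hη0]
    · rw [Matrix.vecMul_vecMul, hBC, Matrix.vecMul_add, ← Matrix.vecMul_vecMul, hη0]
      simp [Matrix.vecMul_smul, Matrix.vecMul_neg, hη0]

theorem IsFourDimSubalgebra.exists_vecMul_eq_smul_of_nilradical_le
    {V : Submodule ℂ (Matrix (Fin 3) (Fin 3) ℂ)} (H : IsFourDimSubalgebra V)
    (h01 : !![0, 1, 0; 0, 0, 0; 0, 0, 0] ∈ V) (h02 : !![0, 0, 1; 0, 0, 0; 0, 0, 0] ∈ V)
    (hV : ∀ v ∈ V, v 1 0 = 0 ∧ v 2 0 = 0) :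
    ∃ η : Fin 3 → ℂ, η ≠ 0 ∧ η 0 = 0 ∧ ∀ v ∈ V, ∃ c : ℂ, η ᵥ* v = c • η := by
  let p : V →ₗ[ℂ] (Fin 2 → ℂ) :=
    { toFun := fun v => ![v.1 0 1, v.1 0 2]
      map_add' := by intro v w; ext i; fin_cases i <;> simp
      map_smul' := by intro r v; ext i; fin_cases i <;> simp }
  have hp : Function.Surjective p := fun c => by
    refine ⟨⟨_, V.add_mem (V.smul_mem (c 0) h01) (V.smul_mem (c 1) h02)⟩, ?_⟩
    ext i; fin_cases i <;> simp [p]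
  have hker : Module.finrank ℂ (LinearMap.ker p) = 2 := by
    have h1 := LinearMap.finrank_range_add_finrank_ker p
    rw [LinearMap.range_eq_top.mpr hp, finrank_top, H.finrank_eq] at h1
    simp at h1
    omega
  let K : Submodule ℂ (Matrix (Fin 3) (Fin 3) ℂ) := (LinearMap.ker p).map V.subtype
  have hK : Module.finrank ℂ K = 2 := by rw [Submodule.finrank_map_subtype_eq, hker]
  have hKV : K ≤ V := Submodule.map_subtype_le V _
  let b := Module.finBasisOfFinrankEq ℂ K hK
  obtain ⟨A, hA⟩ : ∃ A : Matrix (Fin 3) (Fin 3) ℂ, A = b 0 := ⟨_, rfl⟩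
  obtain ⟨B, hB⟩ : ∃ B : Matrix (Fin 3) (Fin 3) ℂ, B = b 1 := ⟨_, rfl⟩
  have hAV : A ∈ V := hA ▸ hKV (b 0).2
  have hBV : B ∈ V := hB ▸ hKV (b 1).2
  have hspan (v) (hv : v ∈ V) : ∃ α β : ℂ, v.submatrix Fin.succ Fin.succ =
      α • A.submatrix (Fin.succ : Fin 2 → Fin 3) (Fin.succ : Fin 2 → Fin 3) +
      β • B.submatrix (Fin.succ : Fin 2 → Fin 3) (Fin.succ : Fin 2 → Fin 3) := by
    let u : V := ⟨_, V.sub_mem (V.sub_mem hv (V.smul_mem (v 0 1) h01)) (V.smul_mem (v 0 2) h02)⟩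
    have hu : u ∈ LinearMap.ker p := by
      rw [LinearMap.mem_ker]
      ext i; fin_cases i <;> simp [p, u]
    have h1 := b.sum_repr ⟨u.1, Submodule.mem_map_of_mem hu⟩
    rw [Fin.sum_univ_two] at h1
    have h2 := congrArg (fun z => (z.1 : Matrix (Fin 3) (Fin 3) ℂ)) h1
    simp only [Submodule.coe_add, Submodule.coe_smul, ← hA, ← hB] at h2
    generalize b.repr _ 0 = α, b.repr _ 1 = β at h2
    refine ⟨α, β, ?_⟩
    ext i j
    have h3 := congrFun (congrFun h2 i.succ) j.succ
    simp only [u, Matrix.sub_apply, Matrix.smul_apply, Matrix.add_apply] at h3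
    simp only [Matrix.add_apply, Matrix.smul_apply, Matrix.submatrix_apply]
    rw [h3]
    fin_cases i <;> fin_cases j <;> simp
  have hmul (v) (hv : v ∈ V) (w) (hw : w ∈ V) : (v * w).submatrix Fin.succ Fin.succ =
      v.submatrix (Fin.succ : Fin 2 → Fin 3) (Fin.succ : Fin 2 → Fin 3) *
      w.submatrix (Fin.succ : Fin 2 → Fin 3) (Fin.succ : Fin 2 → Fin 3) := by
    obtain ⟨h1, h2⟩ := hV v hv
    ext i j
    fin_cases i <;> simp [Matrix.mul_apply, Fin.sum_univ_three, Fin.sum_univ_two, h1, h2]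
  obtain ⟨α, β, hAB⟩ := hspan _ (H.lie_mem A hAV B hBV)
  rw [Matrix.submatrix_sub, Pi.sub_apply, Pi.sub_apply, hmul A hAV B hBV, hmul B hBV A hAV] at hAB
  obtain ⟨η, hη, ⟨s, hs⟩, t, ht⟩ := exists_common_eigenvector hAB
  refine ⟨![0, η 0, η 1], ?_, rfl, fun v hv => ?_⟩
  · intro h
    refine hη (funext fun i => ?_)
    fin_cases i
    · exact congrFun h 1
    · exact congrFun h 2
  · obtain ⟨α, β, h⟩ := hspan v hv
    have h1 : η ᵥ* v.submatrix Fin.succ Fin.succ = (α * s + β * t) • η := by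
      rw [h, Matrix.vecMul_add, Matrix.vecMul_smul, Matrix.vecMul_smul, hs, ht]
      module
    obtain ⟨h10, h20⟩ := hV v hv
    refine ⟨α * s + β * t, ?_⟩
    have e0 := congrFun h1 0
    have e1 := congrFun h1 1
    simp [Matrix.vecMul, dotProduct] at e0 e1
    ext i
    fin_cases i
    · simp [Matrix.vecMul, dotProduct, Fin.sum_univ_three, h10, h20]
    · simpa [Matrix.vecMul, dotProduct, Fin.sum_univ_three] using e0
    · simpa [Matrix.vecMul, dotProduct, Fin.sum_univ_three] using e1

theorem conjEquiv_vecMulVec {P Q : Matrix (Fin 3) (Fin 3) ℂ} (hPQ : P * Q = 1)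
    (hQP : Q * P = 1) (a b : Fin 3 → ℂ) :
    conjEquiv hPQ hQP (vecMulVec a b) = vecMulVec (P *ᵥ a) (b ᵥ* Q) := by
  rw [conjEquiv_apply, Matrix.mul_vecMulVec, Matrix.vecMulVec_mul]

theorem single_zero_one : !![0, 1, 0; 0, 0, 0; 0, 0, 0] =
    vecMulVec (Pi.single 0 1 : Fin 3 → ℂ) (Pi.single 1 1) := by
  ext i j; fin_cases i <;> fin_cases j <;> simp [vecMulVec_apply]

theorem single_zero_two : !![0, 0, 1; 0, 0, 0; 0, 0, 0] =
    vecMulVec (Pi.single 0 1 : Fin 3 → ℂ) (Pi.single 2 1) := by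
  ext i j; fin_cases i <;> fin_cases j <;> simp [vecMulVec_apply]

theorem conjEquiv_symm_apply_zero {P Q : Matrix (Fin 3) (Fin 3) ℂ} (hPQ : P * Q = 1)
    (hQP : Q * P = 1) {y : Matrix (Fin 3) (Fin 3) ℂ} {c : ℂ}
    (h : conjEquiv hPQ hQP y *ᵥ P.col 0 = c • P.col 0) {i : Fin 3} (hi : i ≠ 0) : y i 0 = 0 := by
  have h1 : P.col 0 = P *ᵥ Pi.single 0 1 := by simp
  rw [h1, conjEquiv_apply, Matrix.mulVec_mulVec, Matrix.mul_assoc, hQP, Matrix.mul_one,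
    ← Matrix.mulVec_mulVec, ← Matrix.mulVec_smul] at h
  have h2 := congrArg (Q *ᵥ ·) h
  simp only [Matrix.mulVec_mulVec _ Q P, hQP, Matrix.one_mulVec] at h2
  simpa [hi] using congrFun h2 i

theorem conjEquiv_symm_one_apply {P Q : Matrix (Fin 3) (Fin 3) ℂ} (hPQ : P * Q = 1)
    (hQP : Q * P = 1) {y : Matrix (Fin 3) (Fin 3) ℂ} {c : ℂ}
    (h : Q.row 1 ᵥ* conjEquiv hPQ hQP y = c • Q.row 1) {i : Fin 3} (hi : i ≠ 1) : y 1 i = 0 := by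
  have h1 : Q.row 1 = Pi.single 1 1 ᵥ* Q := by simp
  rw [h1, conjEquiv_apply, Matrix.vecMul_vecMul, ← Matrix.mul_assoc, ← Matrix.mul_assoc, hQP,
    Matrix.one_mul, ← Matrix.vecMul_vecMul, ← Matrix.smul_vecMul] at h
  have h2 := congrArg (· ᵥ* P) h
  simp only [Matrix.vecMul_vecMul _ Q P, hQP, Matrix.vecMul_one] at h2
  simpa [hi] using congrFun h2 i

theorem IsFourDimSubalgebra.exists_vecMul_eq_smul
    {V : Submodule ℂ (Matrix (Fin 3) (Fin 3) ℂ)} (H : IsFourDimSubalgebra V)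
    {x : Fin 3 → ℂ} (hx : x ≠ 0) (hinv : ∀ v ∈ V, ∃ c : ℂ, v *ᵥ x = c • x)
    (hnil : ∀ η : Fin 3 → ℂ, η ⬝ᵥ x = 0 → vecMulVec x η ∈ V) :
    ∃ ξ : Fin 3 → ℂ, ξ ≠ 0 ∧ ξ ⬝ᵥ x = 0 ∧ ∀ v ∈ V, ∃ c : ℂ, ξ ᵥ* v = c • ξ := by
  obtain ⟨ξ₀, hξ₀, h0, -⟩ := exists_ne_zero_and_dotProduct_eq_zero x x
  obtain ⟨P, Q, hPQ, hQP, hP, -⟩ := exists_frame hx hξ₀ (by rwa [dotProduct_comm])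
  obtain rfl : x = P.col 0 := funext fun i => (hP i).symm
  have hdual (b : Fin 3 → ℂ) (hb : b 0 = 0) : (b ᵥ* Q) ⬝ᵥ P.col 0 = 0 := by
    have h1 : P.col 0 = P *ᵥ Pi.single 0 1 := by simp
    rw [h1, ← Matrix.dotProduct_mulVec, Matrix.mulVec_mulVec, hQP, Matrix.one_mulVec]
    simpa using hb
  have hmem (b : Fin 3 → ℂ) (hb : b 0 = 0) :
      vecMulVec (Pi.single 0 1) b ∈ V.comap (conjEquiv hPQ hQP).toLinearMap := by
    rw [Submodule.mem_comap, LinearEquiv.coe_coe, conjEquiv_vecMulVec]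
    simpa using hnil _ (hdual b hb)
  obtain ⟨η, hη, hη0, h⟩ := (H.comap_conjEquiv hPQ hQP).exists_vecMul_eq_smul_of_nilradical_le
    (by rw [single_zero_one]; exact hmem _ (by simp))
    (by rw [single_zero_two]; exact hmem _ (by simp))
    (fun v hv => by
      obtain ⟨c, hc⟩ := hinv _ hv
      exact ⟨conjEquiv_symm_apply_zero hPQ hQP hc (by decide),
        conjEquiv_symm_apply_zero hPQ hQP hc (by decide)⟩)
  refine ⟨η ᵥ* Q, fun hη' => hη ?_, hdual η hη0, fun v hv => ?_⟩
  · have := congrArg (· ᵥ* P) hη'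
    simpa [Matrix.vecMul_vecMul, hQP] using this
  · obtain ⟨c, hc⟩ := h ((conjEquiv hPQ hQP).symm v) (by
      simpa [Submodule.mem_comap, -conjEquiv_apply, -conjEquiv_symm_apply] using hv)
    refine ⟨c, ?_⟩
    have := congrArg (· ᵥ* Q) hc
    simpa [Matrix.vecMul_vecMul, Matrix.mul_assoc, hPQ, Matrix.smul_vecMul] using this

namespace IsHypercomplexPart

variable {V : Submodule ℂ (Matrix (Fin 3) (Fin 3) ℂ)}
  {ψ : Matrix (Fin 3) (Fin 3) ℂ → Matrix (Fin 3) (Fin 3) ℂ}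

theorem star_ne_smul (H : IsHypercomplexPart id V ψ) {x : Fin 3 → ℂ} (hx : x ≠ 0)
    (hinv : ∀ v ∈ V, ∃ c : ℂ, v *ᵥ x = c • x) (k : ℂ) : star x ≠ k • x := by
  intro hk
  have hconj (v) (hv : v ∈ V) : ∃ c : ℂ, sconj id v *ᵥ x = c • x := by
    obtain ⟨c, hc⟩ := hinv v hv
    refine ⟨star c, ?_⟩
    have h1 : v *ᵥ star x = c • star x := by
      rw [hk, Matrix.mulVec_smul, hc, smul_comm]
    have h2 := congrArg star h1
    rw [star_smul, star_star] at h2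
    rw [← h2]
    ext i
    simp [sconj, Matrix.mulVec, dotProduct, Fin.sum_univ_three]
  obtain ⟨i, hi⟩ := Function.ne_iff.mp hx
  obtain ⟨j, hij⟩ := exists_ne i
  obtain ⟨v, hv, w, hw, h⟩ := H.exists_add (Matrix.single j i 1) (by
    simp [Matrix.trace_single_eq_of_ne _ _ _ hij])
  obtain ⟨c, hc⟩ := hinv v hv
  obtain ⟨d, hd⟩ := hconj w hw
  have h1 : Matrix.single j i 1 *ᵥ x = (c + d) • x := by
    rw [h, Matrix.add_mulVec, hc, hd, add_smul]
  have e1 := congrFun h1 i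
  have e2 := congrFun h1 j
  simp [Matrix.single_mulVec, hij.symm] at e1 e2 hi
  rcases e1 with e1 | e1
  · rw [e1, zero_mul] at e2
    exact hi e2
  · exact hi e1

theorem star_ne_smul' (H : IsHypercomplexPart id V ψ) {ξ : Fin 3 → ℂ} (hξ : ξ ≠ 0)
    (hinv : ∀ v ∈ V, ∃ c : ℂ, ξ ᵥ* v = c • ξ) (k : ℂ) : star ξ ≠ k • ξ :=
  H.comap_transpose.star_ne_smul hξ (fun v hv => by
    obtain ⟨c, hc⟩ := hinv _ hv
    refine ⟨c, ?_⟩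
    rw [← hc]
    simp [Matrix.vecMul_transpose]) k

end IsHypercomplexPart

theorem exists_real_ne_zero {ξ : Fin 3 → ℂ} :
    ∃ r : Fin 3 → ℂ, r ≠ 0 ∧ star r = r ∧ ξ ⬝ᵥ r = 0 := by
  obtain ⟨w, hw, h1, h2⟩ := exists_ne_zero_and_dotProduct_eq_zero ξ (star ξ)
  have h3 : ξ ⬝ᵥ star w = 0 := by
    simpa [dotProduct, Fin.sum_univ_three] using congrArg star h2
  by_cases h : w + star w = 0
  · refine ⟨Complex.I • w, by simpa using hw, ?_, by simp [h1]⟩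
    rw [star_smul, ← neg_eq_of_add_eq_zero_right h]
    simp
  · exact ⟨w + star w, h, by rw [star_add, star_star, add_comm], by simp [dotProduct_add, h1, h3]⟩

namespace IsHypercomplexPart

variable {V : Submodule ℂ (Matrix (Fin 3) (Fin 3) ℂ)}
  {ψ : Matrix (Fin 3) (Fin 3) ℂ → Matrix (Fin 3) (Fin 3) ℂ}

theorem dotProduct_star_ne_zero (H : IsHypercomplexPart id V ψ) {x ξ : Fin 3 → ℂ} (hx : x ≠ 0)
    (hξ : ξ ≠ 0) (h : ξ ⬝ᵥ x = 0) (hx' : ∀ v ∈ V, ∃ c : ℂ, v *ᵥ x = c • x)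
    (hξ' : ∀ v ∈ V, ∃ c : ℂ, ξ ᵥ* v = c • ξ) : ξ ⬝ᵥ star x ≠ 0 := by
  intro h0
  obtain ⟨P, Q, hPQ, hQP, hP, hQ⟩ := exists_frame hx hξ h
  have h1 : star ξ ⬝ᵥ x = 0 := by
    simpa [dotProduct, Fin.sum_univ_three] using congrArg star h0
  have h2 : star ξ ⬝ᵥ star x = 0 := by
    simpa [dotProduct, Fin.sum_univ_three] using congrArg star h
  -- the coordinates of `star x` and `star ξ` in the frame
  have hx0 : (Q *ᵥ star x) 1 = 0 := by
    rw [← h0]; simp [Matrix.mulVec, dotProduct, hQ]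
  have hξ0 : (star ξ ᵥ* P) 0 = 0 := by
    rw [← h1]; simp [Matrix.vecMul, dotProduct, hP]
  have hQP0 : (Q *ᵥ star x) 2 ≠ 0 := by
    intro h3
    apply H.star_ne_smul hx hx' ((Q *ᵥ star x) 0)
    have h4 : star x = P *ᵥ (Q *ᵥ star x) := by
      rw [Matrix.mulVec_mulVec, hPQ, Matrix.one_mulVec]
    ext i
    conv_lhs => rw [h4]
    rw [Matrix.mulVec, dotProduct, Fin.sum_univ_three, hx0, h3, hP]
    simp [mul_comm]
  have hξ2 : (star ξ ᵥ* P) 2 = 0 := by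
    have h3 : (star ξ ᵥ* P) ⬝ᵥ (Q *ᵥ star x) = 0 := by
      rw [← Matrix.dotProduct_mulVec, Matrix.mulVec_mulVec, hPQ, Matrix.one_mulVec, h2]
    rw [dotProduct, Fin.sum_univ_three, hx0, hξ0] at h3
    simpa [hQP0] using h3
  apply H.star_ne_smul' hξ hξ' ((star ξ ᵥ* P) 1)
  have h4 : star ξ = (star ξ ᵥ* P) ᵥ* Q := by
    rw [Matrix.vecMul_vecMul, hPQ, Matrix.vecMul_one]
  ext i
  conv_lhs => rw [h4]
  rw [Matrix.vecMul, dotProduct, Fin.sum_univ_three, hξ0, hξ2, hQ]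
  simp

theorem false_of_flag (H : IsHypercomplexPart id V ψ) {x : Fin 3 → ℂ} (hx : x ≠ 0)
    (hinv : ∀ v ∈ V, ∃ c : ℂ, v *ᵥ x = c • x)
    (hnil : ∀ η : Fin 3 → ℂ, η ⬝ᵥ x = 0 → vecMulVec x η ∈ V) : False := by
  obtain ⟨ξ, hξ, hξx, hξ'⟩ := H.isFourDimSubalgebra.exists_vecMul_eq_smul hx hinv hnil
  have hne := H.dotProduct_star_ne_zero hx hξ hξx hinv hξ'
  obtain ⟨r, hr, hrr, hξr⟩ := exists_real_ne_zero (ξ := ξ)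
  let P : Matrix (Fin 3) (Fin 3) ℂ := (Matrix.of ![x, star x, r])ᵀ
  have hmul (c : Fin 3 → ℂ) : P *ᵥ c = c 0 • x + c 1 • star x + c 2 • r := by
    ext i; simp [P, Matrix.mulVec, dotProduct, Fin.sum_univ_three, mul_comm]
  have h1 : star ξ ⬝ᵥ x ≠ 0 := by
    intro h; apply hne
    simpa [dotProduct, Fin.sum_univ_three] using congrArg star h
  have h2 : star ξ ⬝ᵥ star x = 0 := by
    simpa [dotProduct, Fin.sum_univ_three] using congrArg star hξx
  have h3 : star ξ ⬝ᵥ r = 0 := by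
    rw [← hrr]
    simpa [dotProduct, Fin.sum_univ_three] using congrArg star hξr
  have hdet : P.det ≠ 0 := by
    intro hdet
    obtain ⟨c, hc, hc0⟩ := Matrix.exists_mulVec_eq_zero_iff.mpr hdet
    rw [hmul] at hc0
    have e1 := congrArg (ξ ⬝ᵥ ·) hc0
    have e0 := congrArg (star ξ ⬝ᵥ ·) hc0
    simp only [dotProduct_add, dotProduct_smul, hξx, hξr, h2, h3, smul_eq_mul, mul_zero, zero_add,
      add_zero, dotProduct_zero, mul_eq_zero, hne, h1, or_false] at e1 e0
    simp [e0, e1, hr] at hc0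
    exact hc (by ext i; fin_cases i <;> assumption)
  have hPQ : P * P⁻¹ = 1 := Matrix.mul_nonsing_inv _ hdet.isUnit
  have hQP : P⁻¹ * P = 1 := Matrix.nonsing_inv_mul _ hdet.isUnit
  have hP0 : P.col 0 = x := rfl
  have hQ1 : P⁻¹.row 1 = (ξ ⬝ᵥ star x)⁻¹ • ξ := by
    have h4 : ξ ᵥ* P = (ξ ⬝ᵥ star x) • Pi.single 1 1 := by
      ext i; fin_cases i
      · simpa [P, Matrix.vecMul, Matrix.transpose] using hξx
      · simp [P, Matrix.vecMul, Matrix.transpose]; rfl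
      · simpa [P, Matrix.vecMul, Matrix.transpose] using hξr
    have h5 : ξ = (ξ ⬝ᵥ star x) • P⁻¹.row 1 := by
      have := congrArg (· ᵥ* P⁻¹) h4
      simpa [Matrix.vecMul_vecMul, hPQ, Matrix.smul_vecMul] using this
    rw [eq_inv_smul_iff₀ hne]
    exact h5.symm
  have hW := H.comap_conjEquiv (σ := ![1, 0, 2]) hPQ hQP
    (fun i => by fin_cases i <;> rfl) (by
    ext i j
    fin_cases j
    · simp [P]
    · simp [P]
    · simpa [P] using congrFun hrr i)
  have hdual (b : Fin 3 → ℂ) (hb : b 0 = 0) : (b ᵥ* P⁻¹) ⬝ᵥ x = 0 := by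
    have h1 : x = P *ᵥ Pi.single 0 1 := by simp [hP0]
    rw [h1, ← Matrix.dotProduct_mulVec, Matrix.mulVec_mulVec, hQP, Matrix.one_mulVec]
    simpa using hb
  have hmem (b : Fin 3 → ℂ) (hb : b 0 = 0) :
      vecMulVec (Pi.single 0 1) b ∈ V.comap (conjEquiv hPQ hQP).toLinearMap := by
    rw [Submodule.mem_comap, LinearEquiv.coe_coe, conjEquiv_vecMulVec]
    simpa [hP0] using hnil _ (hdual b hb)
  refine hW.false_of_parabolic (by rw [single_zero_one]; exact hmem _ (by simp))
    (by rw [single_zero_two]; exact hmem _ (by simp)) fun v hv => ?_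
  obtain ⟨c, hc⟩ := hinv _ hv
  obtain ⟨d, hd⟩ := hξ' _ hv
  refine ⟨conjEquiv_symm_apply_zero hPQ hQP hc (by decide),
    conjEquiv_symm_apply_zero hPQ hQP hc (by decide),
    conjEquiv_symm_one_apply hPQ hQP (c := d) ?_ (by decide)⟩
  rw [hQ1, Matrix.smul_vecMul, smul_comm]
  exact congrArg _ hd

theorem vecMulVec_notMem (H : IsHypercomplexPart id V ψ) {x ξ : Fin 3 → ℂ} (hx : x ≠ 0)
    (hξ : ξ ≠ 0) (h : ξ ⬝ᵥ x = 0) : vecMulVec x ξ ∉ V := by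
  intro hV
  obtain ⟨P, Q, hPQ, hQP, hP, hQ⟩ := exists_frame hx hξ h
  obtain rfl : x = P.col 0 := funext fun i => (hP i).symm
  obtain rfl : ξ = Q.row 1 := funext fun i => (hQ i).symm
  have hW := H.isFourDimSubalgebra.comap_conjEquiv hPQ hQP
  have hx1 : P.col 0 = P *ᵥ Pi.single 0 1 := by simp
  have hξ1 : Q.row 1 = Pi.single 1 1 ᵥ* Q := by simp
  have h01 : !![0, 1, 0; 0, 0, 0; 0, 0, 0] ∈ V.comap (conjEquiv hPQ hQP).toLinearMap := by
    rw [Submodule.mem_comap, LinearEquiv.coe_coe, vecMulVec_eq_conjEquiv hPQ hQP hP hQ]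
    exact hV
  have hmemsymm (v) (hv : v ∈ V) :
      (conjEquiv hPQ hQP).symm v ∈ V.comap (conjEquiv hPQ hQP).toLinearMap := by
    rw [Submodule.mem_comap, LinearEquiv.coe_coe, LinearEquiv.apply_symm_apply]
    exact hv
  have h10 : ∀ v ∈ V.comap (conjEquiv hPQ hQP).toLinearMap, v 1 0 = 0 := by
    intro v hv
    have := H.dotProduct_mulVec_eq_zero hx hξ h hV hv
    rw [← conjEquiv_symm_one_zero hPQ hQP hP hQ] at this
    simpa [-conjEquiv_apply, -conjEquiv_symm_apply] using this
  rcases hW.parabolic h01 h10 with ⟨h20, h02⟩ | ⟨h12, h21⟩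
  · refine H.false_of_flag hx (fun v hv => ?_) fun η hη => ?_
    · have hu := hmemsymm v hv
      set u := (conjEquiv hPQ hQP).symm v with hudef
      have hv' : v = P * u * Q := by
        rw [← conjEquiv_apply hPQ hQP, hudef, LinearEquiv.apply_symm_apply]
      refine ⟨u 0 0, ?_⟩
      have h1 : u *ᵥ Pi.single 0 1 = u 0 0 • Pi.single 0 1 := by
        ext i; fin_cases i <;> simp [h10 u hu, h20 u hu]
      rw [hx1, hv', Matrix.mulVec_mulVec, Matrix.mul_assoc, hQP, Matrix.mul_one,
        ← Matrix.mulVec_mulVec, h1, Matrix.mulVec_smul]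
    · have h1 : vecMulVec (P.col 0) η = conjEquiv hPQ hQP
          (vecMulVec (Pi.single 0 1) (η ᵥ* P)) := by
        rw [conjEquiv_vecMulVec, Matrix.vecMul_vecMul, hPQ, Matrix.vecMul_one, ← hx1]
      have h2 : (η ᵥ* P) 0 = 0 := hη
      rw [h1]
      change _ ∈ V.comap (conjEquiv hPQ hQP).toLinearMap
      convert Submodule.add_mem _ (Submodule.smul_mem _ ((η ᵥ* P) 1) h01)
        (Submodule.smul_mem _ ((η ᵥ* P) 2) h02) using 1
      ext i j
      fin_cases i <;> fin_cases j <;> simp [vecMulVec_apply, h2]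
  · refine H.comap_transpose.false_of_flag hξ (fun v hv => ?_) fun η hη => ?_
    · have hu := hmemsymm vᵀ hv
      set u := (conjEquiv hPQ hQP).symm vᵀ with hudef
      have hv' : vᵀ = P * u * Q := by
        rw [← conjEquiv_apply hPQ hQP, hudef, LinearEquiv.apply_symm_apply]
      refine ⟨u 1 1, ?_⟩
      have h1 : Pi.single 1 1 ᵥ* u = u 1 1 • Pi.single 1 1 := by
        ext i; fin_cases i <;> simp [h10 u hu, h12 u hu]
      rw [← Matrix.vecMul_transpose, hξ1, hv', Matrix.vecMul_vecMul, ← Matrix.mul_assoc,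
        ← Matrix.mul_assoc, hQP, Matrix.one_mul, ← Matrix.vecMul_vecMul, h1, Matrix.smul_vecMul]
    · have h1 : vecMulVec η (Q.row 1) = conjEquiv hPQ hQP
          (vecMulVec (Q *ᵥ η) (Pi.single 1 1)) := by
        rw [conjEquiv_vecMulVec, Matrix.mulVec_mulVec, hPQ, Matrix.one_mulVec, ← hξ1]
      have h2 : (Q *ᵥ η) 1 = 0 := by
        rw [dotProduct_comm] at hη; exact hη
      change (vecMulVec (Q.row 1) η)ᵀ ∈ V
      rw [Matrix.transpose_vecMulVec, h1]
      change _ ∈ V.comap (conjEquiv hPQ hQP).toLinearMap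
      convert Submodule.add_mem _ (Submodule.smul_mem _ ((Q *ᵥ η) 0) h01)
        (Submodule.smul_mem _ ((Q *ᵥ η) 2) h21) using 1
      ext i j
      fin_cases i <;> fin_cases j <;> simp [vecMulVec_apply, h2]

end IsHypercomplexPart

theorem finrank_le_finrank_map_add_finrank_ker {W : Type*} [AddCommGroup W] [Module ℂ W]
    [FiniteDimensional ℂ W] (f : W →ₗ[ℂ] W) (S : Submodule ℂ W) :
    Module.finrank ℂ S ≤ Module.finrank ℂ (S.map f) + Module.finrank ℂ (LinearMap.ker f) := by
  have h1 := LinearMap.finrank_range_add_finrank_ker (f.domRestrict S)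
  rw [LinearMap.range_domRestrict] at h1
  let g : LinearMap.ker (f.domRestrict S) →ₗ[ℂ] LinearMap.ker f :=
    LinearMap.codRestrict _ (S.subtype ∘ₗ (LinearMap.ker (f.domRestrict S)).subtype)
      fun u => u.2
  have hg : Function.Injective g := fun u v huv => by
    have := congrArg Subtype.val huv
    exact Subtype.ext (Subtype.ext this)
  have h2 := LinearMap.finrank_le_finrank_of_injective hg
  omega

theorem exists_pow_three_apply_ne_zero {W : Type*} [AddCommGroup W] [Module ℂ W]
    [FiniteDimensional ℂ W] (hW : Module.finrank ℂ W = 4) {f : W →ₗ[ℂ] W}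
    (hf : ∀ y, f (f (f (f (f y)))) = 0) (hker : Module.finrank ℂ (LinearMap.ker f) ≤ 1) :
    ∃ y, f (f (f y)) ≠ 0 ∧ f (f (f (f y))) = 0 := by
  have h4 (y : W) : f (f (f (f y))) = 0 := by
    have h := Module.End.ker_pow_le_ker_pow_finrank (K := ℂ) (V := W) f 5
      (show y ∈ LinearMap.ker ((f : Module.End ℂ W) ^ 5) by
        simpa [pow_succ, LinearMap.mem_ker] using hf y)
    rw [hW] at h
    simpa [pow_succ, LinearMap.mem_ker] using h
  by_contra! h
  have h3 (y : W) : f (f (f y)) = 0 := by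
    by_contra h0
    exact h y h0 (h4 y)
  have e1 := finrank_le_finrank_map_add_finrank_ker f ⊤
  have e2 := finrank_le_finrank_map_add_finrank_ker f ((⊤ : Submodule ℂ W).map f)
  have e3 := finrank_le_finrank_map_add_finrank_ker f (((⊤ : Submodule ℂ W).map f).map f)
  have e4 : (((⊤ : Submodule ℂ W).map f).map f).map f = ⊥ := by
    rw [eq_bot_iff]
    rintro _ ⟨_, ⟨_, ⟨y, -, rfl⟩, rfl⟩, rfl⟩
    exact h3 y
  rw [e4, finrank_bot] at e3
  rw [finrank_top] at e1
  omega

theorem exists_eq_vecMulVec {e : Matrix (Fin 3) (Fin 3) ℂ} (he : e * e = 0) (he0 : e ≠ 0)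
    (htr : e.trace = 0) :
    ∃ x ξ : Fin 3 → ℂ, x ≠ 0 ∧ ξ ≠ 0 ∧ ξ ⬝ᵥ x = 0 ∧ e = vecMulVec x ξ := by
  let f := Matrix.mulVecLin e
  have h1 : LinearMap.range f ≤ LinearMap.ker f := by
    rintro _ ⟨y, rfl⟩
    simp [f, LinearMap.mem_ker, Matrix.mulVec_mulVec, he]
  have h2 := LinearMap.finrank_range_add_finrank_ker f
  have h3 := Submodule.finrank_mono h1
  have h4 : Module.finrank ℂ (LinearMap.range f) ≤ 1 := by
    simp at h2
    omega
  obtain ⟨x, hx⟩ := finrank_le_one_iff.mp h4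
  have h5 (y : Fin 3 → ℂ) : ∃ c : ℂ, e *ᵥ y = c • x.1 := by
    obtain ⟨c, hc⟩ := hx ⟨f y, ⟨y, rfl⟩⟩
    exact ⟨c, (congrArg Subtype.val hc).symm⟩
  choose c hc using h5
  have h6 : e = vecMulVec x.1 fun j => c (Pi.single j 1) := by
    ext i j
    have := congrFun (hc (Pi.single j 1)) i
    simpa [vecMulVec_apply, mul_comm] using this
  refine ⟨x.1, fun j => c (Pi.single j 1), ?_, ?_, ?_, h6⟩
  · intro h0
    apply he0
    rw [h6, h0, Matrix.zero_vecMulVec]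
  · intro h0
    apply he0
    rw [h6, h0, Matrix.vecMulVec_zero]
  · rw [dotProduct_comm, ← Matrix.trace_vecMulVec, ← h6, htr]

theorem exists_eq_add_smul_of_commute {e : Matrix (Fin 3) (Fin 3) ℂ} (h3 : e * e * e = 0)
    (h2 : e * e ≠ 0) {M : Matrix (Fin 3) (Fin 3) ℂ} (hM : e * M = M * e) :
    ∃ a b c : ℂ, M = a • 1 + b • e + c • (e * e) := by
  obtain ⟨w, hw⟩ : ∃ w, (e * e) *ᵥ w ≠ 0 := by
    by_contra! h
    exact h2 (Matrix.ext_of_mulVec_single fun i => by rw [h, Matrix.zero_mulVec])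
  let P : Matrix (Fin 3) (Fin 3) ℂ := (Matrix.of ![w, e *ᵥ w, (e * e) *ᵥ w])ᵀ
  have hmul (c : Fin 3 → ℂ) : P *ᵥ c = c 0 • w + c 1 • e *ᵥ w + c 2 • (e * e) *ᵥ w := by
    ext i; simp [P, Matrix.mulVec, dotProduct, Fin.sum_univ_three, mul_comm]
  have he3 : e * (e * e) = 0 := by rw [← Matrix.mul_assoc, h3]
  have he4 : e * e * (e * e) = 0 := by rw [← Matrix.mul_assoc, h3, Matrix.zero_mul]
  have hdet : P.det ≠ 0 := by
    intro hdet
    obtain ⟨c, hc, hc0⟩ := Matrix.exists_mulVec_eq_zero_iff.mpr hdet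
    rw [hmul] at hc0
    have e0 := congrArg ((e * e) *ᵥ ·) hc0
    simp [Matrix.mulVec_add, Matrix.mulVec_smul, Matrix.mulVec_mulVec, h3, he4, hw] at e0
    have e1 := congrArg (e *ᵥ ·) hc0
    simp [Matrix.mulVec_add, Matrix.mulVec_smul, Matrix.mulVec_mulVec, he3, hw, e0] at e1
    simp [e0, e1, hw] at hc0
    exact hc (by ext i; fin_cases i <;> assumption)
  have hPQ : P * P⁻¹ = 1 := Matrix.mul_nonsing_inv _ hdet.isUnit
  let c := P⁻¹ *ᵥ (M *ᵥ w)
  have hc : M *ᵥ w = c 0 • w + c 1 • e *ᵥ w + c 2 • (e * e) *ᵥ w := by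
    rw [← hmul, Matrix.mulVec_mulVec, hPQ, Matrix.one_mulVec]
  refine ⟨c 0, c 1, c 2, ?_⟩
  generalize c 0 = c0, c 1 = c1, c 2 = c2 at hc
  let D := M - (c0 • 1 + c1 • e + c2 • (e * e))
  have hD : e * D = D * e := by
    simp only [D, Matrix.mul_sub, Matrix.sub_mul, Matrix.mul_add, Matrix.add_mul, hM,
      Matrix.mul_smul, Matrix.smul_mul, Matrix.mul_one, Matrix.one_mul, Matrix.mul_assoc]
  have hDw : D *ᵥ w = 0 := by
    simp only [D, Matrix.sub_mulVec, Matrix.add_mulVec, Matrix.smul_mulVec, hc,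
      Matrix.one_mulVec, sub_self]
  have hDe : D *ᵥ (e *ᵥ w) = 0 := by
    rw [Matrix.mulVec_mulVec, ← hD, ← Matrix.mulVec_mulVec, hDw, Matrix.mulVec_zero]
  have hDee : D *ᵥ ((e * e) *ᵥ w) = 0 := by
    rw [← Matrix.mulVec_mulVec, Matrix.mulVec_mulVec, ← hD, ← Matrix.mulVec_mulVec, hDe,
      Matrix.mulVec_zero]
  have hDP : D * P = 0 := by
    refine Matrix.ext_of_mulVec_single fun i => ?_
    rw [← Matrix.mulVec_mulVec, hmul]
    simp only [Matrix.mulVec_add, Matrix.mulVec_smul, hDw, hDe, hDee,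
      Matrix.zero_mulVec, smul_zero, add_zero]
  have hD0 : D = 0 := by
    rw [← Matrix.mul_one D, ← hPQ, ← Matrix.mul_assoc, hDP, Matrix.zero_mul]
  exact sub_eq_zero.mp hD0

theorem IsFourDimSubalgebra.mul_self_mem {V : Submodule ℂ (Matrix (Fin 3) (Fin 3) ℂ)}
    (H : IsFourDimSubalgebra V) {e : Matrix (Fin 3) (Fin 3) ℂ} (he : e ∈ V)
    (h3 : e * e * e = 0) (htr : (e * e).trace = 0) : e * e ∈ V := by
  by_contra hmem
  have h2 : e * e ≠ 0 := fun h => hmem (h ▸ V.zero_mem)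
  have hcomm (M) (hM : M ∈ V) (h : e * M = M * e) : ∃ b : ℂ, M = b • e := by
    obtain ⟨a, b, c, rfl⟩ := exists_eq_add_smul_of_commute h3 h2 h
    have ha := H.trace_eq_zero _ hM
    simp [htr, H.trace_eq_zero e he] at ha
    subst ha
    have hc : c = 0 := by
      by_contra hc
      apply hmem
      have h4 : c • (e * e) ∈ V := by
        have := V.sub_mem hM (V.smul_mem b he)
        simpa using this
      simpa [hc] using V.smul_mem c⁻¹ h4
    exact ⟨b, by simp [hc]⟩
  let f : V →ₗ[ℂ] V :=
    { toFun := fun v => ⟨e * v.1 - v.1 * e, H.lie_mem e he v.1 v.2⟩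
      map_add' := fun v w => Subtype.ext (by simp [Matrix.mul_add, Matrix.add_mul]; abel)
      map_smul' := fun c v => Subtype.ext (by simp [smul_sub]) }
  have hf5 (y : V) : f (f (f (f (f y)))) = 0 := by
    apply Subtype.ext
    have h3' (X : Matrix (Fin 3) (Fin 3) ℂ) : e * (e * (e * X)) = 0 := by
      rw [← Matrix.mul_assoc, ← Matrix.mul_assoc, h3, Matrix.zero_mul]
    have h3'' : e * (e * e) = 0 := by rw [← Matrix.mul_assoc, h3]
    simp [f, Matrix.mul_sub, Matrix.sub_mul, Matrix.mul_assoc, h3', h3'']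
  have hker : Module.finrank ℂ (LinearMap.ker f) ≤ 1 := by
    refine finrank_le_one ⟨⟨e, he⟩, by simp [f, LinearMap.mem_ker]⟩ fun v => ?_
    have hv : f v.1 = 0 := v.2
    obtain ⟨b, hb⟩ := hcomm v.1.1 v.1.2 (sub_eq_zero.mp (congrArg Subtype.val hv))
    exact ⟨b, Subtype.ext (Subtype.ext hb.symm)⟩
  obtain ⟨y, hy, hy4⟩ := exists_pow_three_apply_ne_zero H.finrank_eq hf5 hker
  obtain ⟨b, hb⟩ := hcomm _ (f (f (f y))).2 (sub_eq_zero.mp (congrArg Subtype.val hy4))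
  have hb0 : b ≠ 0 := by
    rintro rfl
    exact hy (Subtype.ext (by simpa using hb))
  have h3' (X : Matrix (Fin 3) (Fin 3) ℂ) : e * (e * (e * X)) = 0 := by
    rw [← Matrix.mul_assoc, ← Matrix.mul_assoc, h3, Matrix.zero_mul]
  have h3'' : e * (e * e) = 0 := by rw [← Matrix.mul_assoc, h3]
  have e1 := congrArg (e * ·) hb
  have e2 := congrArg (· * e) hb
  simp [f, Matrix.mul_sub, Matrix.sub_mul, Matrix.mul_assoc, h3', h3''] at e1 e2
  have e3 : (2 * b) • (e * e) = 0 := by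
    have := congrArg₂ (· + ·) e1 e2
    rw [two_mul, add_smul, ← this]
    abel
  simp [hb0, h2] at e3

theorem finrank_le_finrank_inf_ker_add_one {W : Type*} [AddCommGroup W] [Module ℂ W]
    [FiniteDimensional ℂ W] (U : Submodule ℂ W) (φ : W →ₗ[ℂ] ℂ) :
    Module.finrank ℂ U ≤ Module.finrank ℂ ↥(U ⊓ LinearMap.ker φ) + 1 := by
  have h1 := Submodule.finrank_sup_add_finrank_inf_eq U (LinearMap.ker φ)
  have h2 := LinearMap.finrank_range_add_finrank_ker φ
  have h3 := Submodule.finrank_le (LinearMap.range φ)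
  have h4 := Submodule.finrank_le (U ⊔ LinearMap.ker φ)
  rw [Module.finrank_self] at h3
  omega

theorem exists_ne_zero_of_finrank_pos {W : Type*} [AddCommGroup W] [Module ℂ W]
    [FiniteDimensional ℂ W] {U : Submodule ℂ W} (hU : 0 < Module.finrank ℂ U) :
    ∃ u ∈ U, u ≠ 0 := by
  apply Submodule.exists_mem_ne_zero_of_ne_bot
  rintro rfl
  simp at hU

theorem exists_cubic_eq_zero {p q r s : ℂ} (hs : s ≠ 0) :
    ∃ z : ℂ, p + q * z + r * z ^ 2 + s * z ^ 3 = 0 := by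
  open Polynomial in
  obtain ⟨z, hz⟩ := IsAlgClosed.exists_root (C s * X ^ 3 + C r * X ^ 2 + C q * X + C p)
    (by rw [degree_cubic hs]; decide)
  refine ⟨z, ?_⟩
  simp [Polynomial.IsRoot] at hz
  linear_combination hz

theorem exists_quadratic_eq_zero_of_ne_zero {p q r : ℂ} (hr : r ≠ 0) :
    ∃ z : ℂ, p + q * z + r * z ^ 2 = 0 := by
  open Polynomial in
  obtain ⟨z, hz⟩ := IsAlgClosed.exists_root (C r * X ^ 2 + C q * X + C p)
    (by rw [degree_quadratic hr]; decide)
  refine ⟨z, ?_⟩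
  simp [Polynomial.IsRoot] at hz
  linear_combination hz

theorem exists_trace_mul_self_eq_zero {U : Submodule ℂ (Matrix (Fin 3) (Fin 3) ℂ)}
    (hU : 2 ≤ Module.finrank ℂ U) : ∃ v ∈ U, v ≠ 0 ∧ (v * v).trace = 0 := by
  obtain ⟨a, haU, ha⟩ := exists_ne_zero_of_finrank_pos (U := U) (by omega)
  obtain ⟨i, hi⟩ := Function.ne_iff.mp ha
  obtain ⟨j, hij⟩ := Function.ne_iff.mp hi
  have h1 := finrank_le_finrank_inf_ker_add_one U (Matrix.entryLinearMap ℂ ℂ i j)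
  obtain ⟨b, ⟨hbU, hb⟩, hb0⟩ := exists_ne_zero_of_finrank_pos
    (U := U ⊓ LinearMap.ker (Matrix.entryLinearMap ℂ ℂ i j)) (by omega)
  have hb : b i j = 0 := hb
  by_cases hbb : (b * b).trace = 0
  · exact ⟨b, hbU, hb0, hbb⟩
  obtain ⟨z, hz⟩ := exists_quadratic_eq_zero_of_ne_zero (p := (a * a).trace)
    (q := 2 * (a * b).trace) hbb
  refine ⟨a + z • b, U.add_mem haU (U.smul_mem z hbU), fun h => hij ?_, ?_⟩
  · simpa [hb] using congrFun (congrFun h i) j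
  · simp only [Matrix.add_mul, Matrix.mul_add, Matrix.smul_mul, Matrix.mul_smul,
      Matrix.trace_add, Matrix.trace_smul, Matrix.trace_mul_comm b a, smul_eq_mul]
    linear_combination hz

theorem exists_trace_pow_eq_zero {V : Submodule ℂ (Matrix (Fin 3) (Fin 3) ℂ)}
    (hV : Module.finrank ℂ V = 4) :
    ∃ e ∈ V, e ≠ 0 ∧ (e * e).trace = 0 ∧ (e * e * e).trace = 0 := by
  obtain ⟨a, haV, ha, haa⟩ := exists_trace_mul_self_eq_zero (U := V) (by omega)
  obtain ⟨i, hi⟩ := Function.ne_iff.mp ha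
  obtain ⟨j, hij⟩ := Function.ne_iff.mp hi
  let φ : Matrix (Fin 3) (Fin 3) ℂ →ₗ[ℂ] ℂ :=
    Matrix.traceLinearMap (Fin 3) ℂ ℂ ∘ₗ LinearMap.mulLeft ℂ a
  have h1 := finrank_le_finrank_inf_ker_add_one V (Matrix.entryLinearMap ℂ ℂ i j)
  have h2 := finrank_le_finrank_inf_ker_add_one
    (V ⊓ LinearMap.ker (Matrix.entryLinearMap ℂ ℂ i j)) φ
  obtain ⟨b, ⟨⟨hbV, hb⟩, hab⟩, hb0, hbb⟩ := exists_trace_mul_self_eq_zero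
    (U := (V ⊓ LinearMap.ker (Matrix.entryLinearMap ℂ ℂ i j)) ⊓ LinearMap.ker φ) (by omega)
  have hb : b i j = 0 := hb
  have hab : (a * b).trace = 0 := hab
  by_cases hbbb : (b * b * b).trace = 0
  · exact ⟨b, hbV, hb0, hbb, hbbb⟩
  obtain ⟨z, hz⟩ := exists_cubic_eq_zero (p := (a * a * a).trace)
    (q := (a * a * b).trace + (a * b * a).trace + (b * a * a).trace)
    (r := (a * b * b).trace + (b * a * b).trace + (b * b * a).trace) hbbb
  refine ⟨a + z • b, V.add_mem haV (V.smul_mem z hbV), fun h => hij ?_, ?_, ?_⟩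
  · simpa [hb] using congrFun (congrFun h i) j
  · simp only [Matrix.add_mul, Matrix.mul_add, Matrix.smul_mul, Matrix.mul_smul,
      Matrix.trace_add, Matrix.trace_smul, Matrix.trace_mul_comm b a, smul_eq_mul, haa, hab, hbb]
    simp
  · simp only [Matrix.add_mul, Matrix.mul_add, Matrix.smul_mul, Matrix.mul_smul,
      Matrix.trace_add, Matrix.trace_smul, smul_eq_mul]
    linear_combination hz

theorem mul_mul_self_eq_zero {e : Matrix (Fin 3) (Fin 3) ℂ} (h1 : e.trace = 0)
    (h2 : (e * e).trace = 0) (h3 : (e * e * e).trace = 0) : e * e * e = 0 := by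
  have key : e * e * e = e.trace • (e * e) - ((e.trace ^ 2 - (e * e).trace) / 2) • e +
      ((e.trace ^ 3 - 3 * e.trace * (e * e).trace + 2 * (e * e * e).trace) / 6) •
        (1 : Matrix (Fin 3) (Fin 3) ℂ) := by
    ext i j
    fin_cases i <;> fin_cases j <;>
    · simp [Matrix.trace_fin_three, Matrix.mul_apply, Fin.sum_univ_three]
      ring
  rw [key, h1, h2, h3]
  simp

theorem IsFourDimSubalgebra.exists_vecMulVec_mem {V : Submodule ℂ (Matrix (Fin 3) (Fin 3) ℂ)}
    (H : IsFourDimSubalgebra V) :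
    ∃ x ξ : Fin 3 → ℂ, x ≠ 0 ∧ ξ ≠ 0 ∧ ξ ⬝ᵥ x = 0 ∧ vecMulVec x ξ ∈ V := by
  obtain ⟨e, heV, he, h2, h3⟩ := exists_trace_pow_eq_zero H.finrank_eq
  have he3 := mul_mul_self_eq_zero (H.trace_eq_zero e heV) h2 h3
  by_cases hee : e * e = 0
  · obtain ⟨x, ξ, hx, hξ, h, rfl⟩ := exists_eq_vecMulVec hee he (H.trace_eq_zero e heV)
    exact ⟨x, ξ, hx, hξ, h, heV⟩
  · have hmem := H.mul_self_mem heV he3 h2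
    obtain ⟨x, ξ, hx, hξ, h, hxξ⟩ := exists_eq_vecMulVec
      (by rw [← Matrix.mul_assoc, he3, Matrix.zero_mul]) hee h2
    exact ⟨x, ξ, hx, hξ, h, hxξ ▸ hmem⟩

/-- The Lie algebra `sl(3,ℝ)`. -/
abbrev slThree := LieAlgebra.SpecialLinear.sl (Fin 3) ℝ

theorem slThree_trace_eq_zero (A : slThree) : A.1.trace = 0 := A.2

theorem slThree_finrank : Module.finrank ℝ slThree = 8 := by
  have h1 := LinearMap.finrank_range_add_finrank_ker (Matrix.traceLinearMap (Fin 3) ℝ ℝ)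
  have h2 : LinearMap.range (Matrix.traceLinearMap (Fin 3) ℝ ℝ) = ⊤ :=
    LinearMap.range_eq_top.mpr fun c => ⟨c • Matrix.single 0 0 1, by simp⟩
  rw [h2, finrank_top, Module.finrank_self, Module.finrank_matrix] at h1
  simp at h1
  have h3 : Module.finrank ℝ slThree =
    Module.finrank ℝ (LinearMap.ker (Matrix.traceLinearMap (Fin 3) ℝ ℝ)) := rfl
  omega

/-- The complex matrix `A + i B`. -/
def cplx (A B : slThree) : Matrix (Fin 3) (Fin 3) ℂ := Matrix.of fun i j => ⟨A.1 i j, B.1 i j⟩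

theorem cplx_injective {A B C D : slThree} (h : cplx A B = cplx C D) : A = C ∧ B = D := by
  constructor <;> ext i j
  · exact congrArg Complex.re (congrFun (congrFun h i) j)
  · exact congrArg Complex.im (congrFun (congrFun h i) j)

theorem exists_eq_cplx {M : Matrix (Fin 3) (Fin 3) ℂ} (hM : M.trace = 0) :
    ∃ A B : slThree, M = cplx A B := by
  refine ⟨⟨M.map Complex.re, ?_⟩, ⟨M.map Complex.im, ?_⟩, rfl⟩
  · change (M.map Complex.re).trace = 0
    simpa [Matrix.trace] using congrArg Complex.re hM
  · change (M.map Complex.im).trace = 0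
    simpa [Matrix.trace] using congrArg Complex.im hM

theorem cplx_trace (A B : slThree) : (cplx A B).trace = 0 := by
  have h1 := slThree_trace_eq_zero A
  have h2 := slThree_trace_eq_zero B
  simp only [Matrix.trace, Matrix.diag, Fin.sum_univ_three] at h1 h2
  apply Complex.ext <;> simp [cplx, Matrix.trace, Fin.sum_univ_three, h1, h2]

theorem cplx_add (A B C D : slThree) : cplx A B + cplx C D = cplx (A + C) (B + D) := by
  ext i j; apply Complex.ext <;> simp [cplx]

theorem cplx_sub (A B C D : slThree) : cplx A B - cplx C D = cplx (A - C) (B - D) := by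
  ext i j; apply Complex.ext <;> simp [cplx]

theorem cplx_neg (A B : slThree) : -cplx A B = cplx (-A) (-B) := by
  ext i j; apply Complex.ext <;> simp [cplx]

theorem cplx_smul (a : ℂ) (A B : slThree) :
    a • cplx A B = cplx (a.re • A - a.im • B) (a.re • B + a.im • A) := by
  ext i j; apply Complex.ext <;> simp [cplx]

theorem cplx_lie (A B C D : slThree) :
    cplx A B * cplx C D - cplx C D * cplx A B =
      cplx (⁅A, C⁆ - ⁅B, D⁆) (⁅A, D⁆ + ⁅B, C⁆) := by
  ext i j
  apply Complex.ext <;>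
  · simp [cplx, Matrix.mul_apply, Fin.sum_univ_three, LieAlgebra.SpecialLinear.sl_bracket,
      -LieSubalgebra.coe_bracket]
    ring

theorem sconj_cplx (A B : slThree) : sconj id (cplx A B) = cplx A (-B) := by
  ext i j; apply Complex.ext <;> simp [cplx, sconj]

/-- The `(1,0)`-part of `sl(3,ℂ)` with respect to a complex structure `J` on `sl(3,ℝ)`. -/
def holomorphicPart (J : slThree →ₗ[ℝ] slThree) (hJ : ∀ A, J (J A) = -A) :
    Submodule ℂ (Matrix (Fin 3) (Fin 3) ℂ) where
  carrier := Set.range fun A => cplx A (-J A)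
  zero_mem' := ⟨0, by ext i j; apply Complex.ext <;> simp [cplx]⟩
  add_mem' := by
    rintro _ _ ⟨A, rfl⟩ ⟨B, rfl⟩
    exact ⟨A + B, by simp only [cplx_add, map_add]; congr 1; abel⟩
  smul_mem' := by
    rintro a _ ⟨A, rfl⟩
    refine ⟨a.re • A + a.im • J A, ?_⟩
    simp only [cplx_smul, map_add, map_smul, hJ]
    congr 1 <;> module

theorem finrank_holomorphicPart (J : slThree →ₗ[ℝ] slThree) (hJ : ∀ A, J (J A) = -A) :
    Module.finrank ℂ (holomorphicPart J hJ) = 4 := by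
  let θ : slThree →ₗ[ℝ] holomorphicPart J hJ :=
    { toFun := fun A => ⟨cplx A (-J A), A, rfl⟩
      map_add' := fun A B => Subtype.ext (by simp [cplx_add]; congr 1; abel)
      map_smul' := fun c A => Subtype.ext (by
        ext i j; apply Complex.ext <;> simp [cplx]) }
  have hθ : Function.Bijective θ := by
    constructor
    · intro A B h
      exact (cplx_injective (congrArg Subtype.val h)).1
    · rintro ⟨_, A, rfl⟩
      exact ⟨A, rfl⟩
  have h1 := (LinearEquiv.ofBijective θ hθ).finrank_eq
  have h2 := finrank_real_of_complex (holomorphicPart J hJ)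
  rw [slThree_finrank] at h1
  omega

theorem exists_isHypercomplexPart {J K : slThree →ₗ[ℝ] slThree} (hJ : ∀ A, J (J A) = -A)
    (hK : ∀ A, K (K A) = -A) (hJK : ∀ A, J (K A) = -K (J A))
    (hNJ : ∀ A B, nijenhuis J A B = 0) (hNK : ∀ A B, nijenhuis K A B = 0) :
    ∃ V ψ, IsHypercomplexPart id V ψ := by
  have hinj : Function.Injective fun A => cplx A (-J A) := fun A B h => (cplx_injective h).1
  have hJlie (A B) : J (⁅A, B⁆ - ⁅J A, J B⁆) = ⁅J A, B⁆ + ⁅A, J B⁆ := by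
    have h := congrArg J (hNJ A B)
    simp only [nijenhuis, map_add, map_sub, hJ, map_zero] at h ⊢
    rw [← sub_eq_zero, ← h]
    abel
  have hKlie (A B) : K ⁅A, B⁆ = ⁅K A, B⁆ + ⁅A, K B⁆ + K ⁅K A, K B⁆ := by
    have h := congrArg K (hNK A B)
    simp only [nijenhuis, map_add, map_sub, hK, map_zero] at h
    rw [← sub_eq_zero, ← h]
    abel
  have hlie (A B) : cplx A (-J A) * cplx B (-J B) - cplx B (-J B) * cplx A (-J A) =
      cplx (⁅A, B⁆ - ⁅J A, J B⁆) (-J (⁅A, B⁆ - ⁅J A, J B⁆)) := by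
    rw [cplx_lie, hJlie]
    congr 1 <;> simp
  refine ⟨holomorphicPart J hJ, fun M => cplx (K (Function.invFun (fun A => cplx A (-J A)) M))
    (-J (K (Function.invFun (fun A => cplx A (-J A)) M))), ?_⟩
  have hinv (A) : Function.invFun (fun A => cplx A (-J A)) (cplx A (-J A)) = A :=
    Function.leftInverse_invFun hinj A
  have hsmul (a : ℂ) (A) : a • cplx A (-J A) =
      cplx (a.re • A + a.im • J A) (-J (a.re • A + a.im • J A)) := by
    simp only [cplx_smul, map_add, map_smul, hJ]
    congr 1 <;> module
  constructor
  · rintro _ ⟨A, rfl⟩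
    exact cplx_trace _ _
  · rintro _ ⟨A, rfl⟩ _ ⟨B, rfl⟩
    exact ⟨_, (hlie A B).symm⟩
  · exact finrank_holomorphicPart J hJ
  · rintro _ ⟨A, rfl⟩ ⟨B, h⟩
    simp only [sconj_cplx, neg_neg] at h
    obtain ⟨rfl, h⟩ := cplx_injective h
    have h0 : J B = 0 := by
      rw [show J B = (2⁻¹ : ℝ) • (J B + J B) by module, add_eq_zero_iff_neg_eq.mpr h, smul_zero]
    have h1 : B = 0 := by rw [← neg_eq_zero, ← hJ, h0, map_zero]
    ext i j; apply Complex.ext <;> simp [cplx, h1]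
  · intro M hM
    obtain ⟨A, B, rfl⟩ := exists_eq_cplx hM
    refine ⟨_, ⟨(2⁻¹ : ℝ) • (A + J B), rfl⟩, _, ⟨(2⁻¹ : ℝ) • (A - J B), rfl⟩, ?_⟩
    simp only [sconj_cplx, cplx_add, map_add, map_sub, map_smul, hJ]
    congr 1 <;> module
  · rintro _ ⟨A, rfl⟩
    exact ⟨_, rfl⟩
  · rintro a _ ⟨A, rfl⟩
    have h1 : K (a.re • A + a.im • J A) =
        (starRingEnd ℂ a).re • K A + (starRingEnd ℂ a).im • J (K A) := by
      simp [hJK]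
    simp only [hsmul, hinv, h1]
  · rintro _ ⟨A, rfl⟩
    simp only [hinv, hK, cplx_neg, map_neg]
  · rintro _ ⟨A, rfl⟩ _ ⟨B, rfl⟩
    simp only [hlie, hinv, sconj_cplx, cplx_lie, cplx_sub, neg_neg]
    refine ⟨K (⁅K A, K B⁆ - ⁅J (K A), J (K B)⁆), ?_⟩
    have e1 := hKlie A B
    have e2 := hKlie (J A) (J B)
    have e3 := hKlie (J A) B
    have e4 := hKlie A (J B)
    have hKJ (A) : K (J A) = -J (K A) := by rw [hJK, neg_neg]
    simp only [hKJ, lie_neg, neg_lie, neg_neg, map_neg] at e1 e2 e3 e4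
    refine congrArg₂ cplx ?_ ?_
    · simp only [map_sub, e1, e2, lie_neg, neg_lie]
      abel
    · rw [hJK (⁅A, B⁆ - ⁅J A, J B⁆), hJK (⁅K A, K B⁆ - ⁅J (K A), J (K B)⁆), hJlie, hJlie]
      simp only [map_add, e3, e4, lie_neg, neg_lie]
      abel

/-- The Lie algebra `sl(3,ℝ)` of traceless `3 × 3` real matrices admits no
hypercomplex structure: there is no pair of linear endomorphisms `J₁, J₂` of `sl(3,ℝ)`
with `J₁² = J₂² = -Id`, `J₁J₂ = -J₂J₁`, and vanishing Nijenhuis tensors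
`N_{J₁} = N_{J₂} = N_{J₁J₂} = 0`. -/
theorem stmt4 :
    ¬ ∃ J1 J2 : (LieAlgebra.SpecialLinear.sl (Fin 3) ℝ) →ₗ[ℝ]
        (LieAlgebra.SpecialLinear.sl (Fin 3) ℝ),
      J1 ∘ₗ J1 = -LinearMap.id ∧ J2 ∘ₗ J2 = -LinearMap.id ∧
      J1 ∘ₗ J2 = -(J2 ∘ₗ J1) ∧
      (∀ x y, nijenhuis J1 x y = 0) ∧
      (∀ x y, nijenhuis J2 x y = 0) ∧
      (∀ x y, nijenhuis (J1 ∘ₗ J2) x y = 0) := by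
  rintro ⟨J, K, hJ, hK, hJK, hNJ, hNK, -⟩
  obtain ⟨V, ψ, H⟩ := exists_isHypercomplexPart (fun A => LinearMap.congr_fun hJ A)
    (fun A => LinearMap.congr_fun hK A) (fun A => LinearMap.congr_fun hJK A) hNJ hNK
  obtain ⟨x, ξ, hx, hξ, h, hV⟩ := H.isFourDimSubalgebra.exists_vecMulVec_mem
  exact H.vecMulVec_notMem hx hξ h hV
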